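/- arXiv:1810.08971 — 3 statements merged into one kernel-verified Lean document; each statement's English description precedes it below -/
import Mathlib

section
/- Let α ∈ S_n be a single cycle and β ∈ S_n with 0 < |M([α,β])| ≤ 4, i.e., the commutator [α,β] = α⁻¹β⁻¹αβ is nontrivial and moves at most 4 points. Then there exists a permutation γ ∈ S_n such that γ⁻¹αγ = α⁻¹ and γ⁻¹βγ = β⁻¹. -/
open Equiv

section Ret
variable {X : Type*} [Finite X]

theorem ret_exists (f : Perm X) (A : Set X) (x : A) : ∃ k : ℕ, 0 < k ∧ (f ^ k) x.1 ∈ A :=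
  ⟨orderOf f, orderOf_pos f, by rw [pow_orderOf_eq_one]; exact x.2⟩

open Classical in
noncomputable def tm (f : Perm X) (A : Set X) (x : A) : ℕ := Nat.find (ret_exists f A x)

noncomputable def ret (f : Perm X) (A : Set X) (x : A) : A :=
  ⟨(f ^ (tm f A x)) x.1, by
    classical
    exact (Nat.find_spec (ret_exists f A x)).2⟩

theorem tm_pos (f : Perm X) (A : Set X) (x : A) : 0 < tm f A x := by
  classical
  exact (Nat.find_spec (ret_exists f A x)).1

theorem tm_le (f : Perm X) (A : Set X) (x : A) {k : ℕ} (hk : 0 < k) (h : (f ^ k) x.1 ∈ A) :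
    tm f A x ≤ k := by
  classical
  exact Nat.find_min' (ret_exists f A x) ⟨hk, h⟩

theorem tm_min (f : Perm X) (A : Set X) (x : A) {k : ℕ} (hk : 0 < k) (h : k < tm f A x) :
    (f ^ k) x.1 ∉ A := fun h' => absurd (tm_le f A x hk h') (by omega)

theorem ret_val (f : Perm X) (A : Set X) (x : A) : (ret f A x).1 = (f ^ (tm f A x)) x.1 := rfl

theorem ret_eq_of (f : Perm X) (A : Set X) (x y : A) (k : ℕ) (hk : 0 < k)
    (h : (f ^ k) x.1 = y.1) (hmin : ∀ j, 0 < j → j < k → (f ^ j) x.1 ∉ A) :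
    tm f A x = k ∧ ret f A x = y := by
  have h1 : tm f A x = k := by
    apply le_antisymm
    · exact tm_le f A x hk (by rw [h]; exact y.2)
    · by_contra hlt
      exact hmin _ (tm_pos f A x) (by omega) (ret f A x).2
  refine ⟨h1, Subtype.ext ?_⟩
  rw [ret_val, h1, h]

theorem ret_inj (f : Perm X) (A : Set X) : Function.Injective (ret f A) := by
  intro x y hxy
  wlog hle : tm f A x ≤ tm f A y generalizing x y
  · exact (this hxy.symm (by omega)).symm
  have h := congrArg Subtype.val hxy
  rw [ret_val, ret_val] at h
  obtain ⟨d, hd⟩ := Nat.exists_eq_add_of_le hle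
  rw [hd, pow_add, Perm.mul_apply] at h
  have h := (f ^ tm f A x).injective h
  rcases Nat.eq_zero_or_pos d with h0 | h0
  · subst h0
    exact Subtype.ext (by simpa using h)
  · exact absurd (h ▸ x.2) (tm_min f A y h0 (by have := tm_pos f A x; omega))

theorem ret_iter (f : Perm X) (A : Set X) (k : ℕ) :
    ∀ x y : A, (f ^ k) x.1 = y.1 → ∃ j : ℕ, (ret f A)^[j] x = y := by
  induction k using Nat.strong_induction_on with
  | _ k ih =>
    intro x y h
    rcases Nat.eq_zero_or_pos k with h0 | h0
    · subst h0
      exact ⟨0, Subtype.ext (by simpa using h)⟩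
    · have hle := tm_le f A x h0 (h ▸ y.2)
      have hp := tm_pos f A x
      obtain ⟨j, hj⟩ := ih (k - tm f A x) (by omega) (ret f A x) y (by
        rw [ret_val, ← Perm.mul_apply, ← pow_add, Nat.sub_add_cancel hle, h])
      exact ⟨j + 1, by rw [Function.iterate_succ_apply, hj]⟩
end Ret

theorem small {D : Type*} [Fintype D] [Nonempty D] (N Q : D → D)
    (hN : ∀ x y, ∃ j : ℕ, N^[j] x = y) (hQ : ∀ x y, ∃ j : ℕ, Q^[j] x = y)
    (hQi : Q.Injective)
    (hne : ∀ x, Q x ≠ N x) (hc : Fintype.card D ≤ 4) :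
    3 ≤ Fintype.card D ∧ ∀ x, Q (N x) = x := by
  classical
  have inv : ∀ F : D → D, (∀ x y, ∃ j : ℕ, F^[j] x = y) → ∀ A : Finset D, A.Nonempty →
      (∀ x ∈ A, F x ∈ A) → Fintype.card D ≤ A.card := by
    intro F hF A ⟨x, hx⟩ hA
    have : A = Finset.univ := by
      rw [Finset.eq_univ_iff_forall]
      intro y
      obtain ⟨j, rfl⟩ := hF x y
      induction j with
      | zero => exact hx
      | succ j ih => rw [Function.iterate_succ_apply']; exact hA _ ih
    rw [this, Finset.card_univ]
  have no1 : ∀ F : D → D, (∀ x y, ∃ j : ℕ, F^[j] x = y) → ∀ x, F x = x → Fintype.card D ≤ 1 := by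
    intro F hF x hx
    simpa using inv F hF {x} (by simp) (by simp [hx])
  have no2 : ∀ F : D → D, (∀ x y, ∃ j : ℕ, F^[j] x = y) → ∀ x, F (F x) = x →
      Fintype.card D ≤ 2 := by
    intro F hF x hx
    exact (inv F hF {x, F x} (by simp) (by simp [hx])).trans Finset.card_le_two
  have no3 : ∀ F : D → D, (∀ x y, ∃ j : ℕ, F^[j] x = y) → ∀ x, F (F (F x)) = x →
      Fintype.card D ≤ 3 := by
    intro F hF x hx
    exact (inv F hF {x, F x, F (F x)} (by simp) (by simp [hx])).trans Finset.card_le_three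
  have all : ∀ A : Finset D, Fintype.card D ≤ A.card → ∀ y, y ∈ A := by
    intro A hA y
    have : A = Finset.univ := (Finset.card_eq_iff_eq_univ A).1 (le_antisymm (Finset.card_le_univ A) hA)
    rw [this]; exact Finset.mem_univ y
  have hpos : 0 < Fintype.card D := Fintype.card_pos
  have c : Fintype.card D = 1 ∨ Fintype.card D = 2 ∨ Fintype.card D = 3 ∨ Fintype.card D = 4 := by omega
  rcases c with c | c | c | c
  · obtain ⟨x⟩ := ‹Nonempty D›
    have := Fintype.card_le_one_iff.1 c.le
    exact absurd (this _ _) (hne x)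
  · obtain ⟨x⟩ := ‹Nonempty D›
    have h1 : N x ≠ x := fun h => by have := no1 N hN x h; omega
    have h2 : Q x ≠ x := fun h => by have := no1 Q hQ x h; omega
    have := all {x, N x} (by rw [Finset.card_pair h1.symm]; omega) (Q x)
    simp at this
    have := hne x
    tauto
  · refine ⟨by omega, fun x => ?_⟩
    have n1 : ∀ x, N x ≠ x := fun x h => by have := no1 N hN x h; omega
    have n2 : ∀ x, N (N x) ≠ x := fun x h => by have := no2 N hN x h; omega
    have q1 : ∀ x, Q x ≠ x := fun x h => by have := no1 Q hQ x h; omega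
    have := all {x, N x, N (N x)} (by
      rw [Finset.card_eq_three.2 ⟨x, N x, N (N x), (n1 _).symm, (n2 _).symm, (n1 _).symm, rfl⟩]; omega)
    simp only [Finset.mem_insert, Finset.mem_singleton] at this
    have t := this (Q (N x))
    have a := hne (N x)
    have b := q1 (N x)
    tauto
  · refine ⟨by omega, fun x => ?_⟩
    have n1 : ∀ x, N x ≠ x := fun x h => by have := no1 N hN x h; omega
    have n2 : ∀ x, N (N x) ≠ x := fun x h => by have := no2 N hN x h; omega
    have n3 : ∀ x, N (N (N x)) ≠ x := fun x h => by have := no3 N hN x h; omega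
    have q1 : ∀ x, Q x ≠ x := fun x h => by have := no1 Q hQ x h; omega
    have q2 : ∀ x, Q (Q x) ≠ x := fun x h => by have := no2 Q hQ x h; omega
    have q3 : ∀ x, Q (Q (Q x)) ≠ x := fun x h => by have := no3 Q hQ x h; omega
    have := all {x, N x, N (N x), N (N (N x))} (by
      rw [Finset.card_eq_of_equiv_fin (n := 4) ?_]
      · omega
      · apply Finset.equivFinOfCardEq
        rw [Finset.card_insert_of_notMem, Finset.card_eq_three.2 ⟨_, _, _, (n1 _).symm, (n2 _).symm, (n1 _).symm, rfl⟩]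
        simp only [Finset.mem_insert, Finset.mem_singleton]
        have := n1 x
        have := n2 x
        have := n3 x
        grind)
    simp only [Finset.mem_insert, Finset.mem_singleton] at this
    have n4 : N (N (N (N x))) = x := by
      have t := this (N (N (N (N x))))
      have := n1 (N (N (N x)))
      have := n2 (N (N x))
      have := n3 (N x)
      tauto
    by_contra hcon
    have t1 := this (Q (N x))
    have a1 := hne (N x)
    have b1 := q1 (N x)
    have e1 : Q (N x) = N (N (N x)) := by tauto
    have t2 := this (Q (N (N (N x))))
    have e2 : Q (N (N (N x))) = N (N x) := by grind
    have e3 : Q (N (N x)) = x := by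
      have t3 := this (Q (N (N x)))
      grind
    have e4 : Q x = N x := by
      have t3 := this (Q x)
      grind
    exact hne x e4

section Z
variable {m : ℕ} [NeZero m]

theorem zlemma (b : Perm (ZMod m)) (D : Finset (ZMod m)) (hD : ∀ x, x ∈ D ↔ b (x + 1) ≠ b x + 1)
    (hne : D.Nonempty) (hc : D.card ≤ 4) :
    3 ≤ D.card ∧ ∃ s, (∀ x, b (s - b x) = s - x) ∧
      ∀ p, p ∈ D → p - 1 ∈ D → s = p + b p := by
  classical
  set f : Perm (ZMod m) := Equiv.addRight 1 with hf
  set f' : Perm (ZMod m) := b⁻¹ * f * b with hf'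
  have fk : ∀ (k : ℕ) x, (f ^ k) x = x + k := by
    intro k x
    induction k with
    | zero => simp
    | succ k ih => rw [pow_succ', Perm.mul_apply, ih]; simp [hf]; ring
  have fk' : ∀ (k : ℕ) x, b ((f' ^ k) x) = b x + k := by
    intro k x
    induction k with
    | zero => simp
    | succ k ih =>
      rw [pow_succ', Perm.mul_apply, hf', Perm.mul_apply, Perm.mul_apply, ← hf', ih]
      simp [hf]; ring
  set A : Set (ZMod m) := (D : Set (ZMod m)) with hA
  have memA : ∀ x, x ∈ A ↔ b (x + 1) ≠ b x + 1 := fun x => by rw [hA, Finset.mem_coe, hD]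
  set N := ret f A with hNdef
  set Q := ret f' A with hQdef
  have Nval : ∀ d : A, (N d).1 = d.1 + (tm f A d : ℕ) := fun d => by
    rw [hNdef, ret_val, fk]
  have blk : ∀ (d : A) (j : ℕ), j + 1 ≤ tm f A d → b (d.1 + (j + 1 : ℕ)) = b (d.1 + 1) + j := by
    intro d j
    induction j with
    | zero => intro _; simp
    | succ j ih =>
      intro hj
      have h1 := tm_min f A d (k := j + 1) (by omega) (by omega)
      rw [fk, memA, not_not, ih (by omega)] at h1
      push_cast at h1 ⊢
      rw [← add_assoc]
      rw [h1]; ring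
  have cD : ∀ d : A, ∃ e : A, b (e.1 + 1) = b d.1 + 1 ∧ Q d = N e := by
    intro d
    have hy : b (b.symm (b d.1 + 1)) = b d.1 + 1 := b.apply_symm_apply _
    set y := b.symm (b d.1 + 1) with hydef
    have he : y - 1 ∈ A := by
      rw [memA]
      intro h
      rw [sub_add_cancel, hy] at h
      have h2 := b.injective (add_right_cancel h)
      have h3 := (memA d.1).1 d.2
      apply h3
      rw [h2, sub_add_cancel, ← h2, hy]
    refine ⟨⟨y - 1, he⟩, by simpa using hy, ?_⟩
    set e : A := ⟨y - 1, he⟩ with hedef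
    have hb1 : b (e.1 + 1) = b d.1 + 1 := by simpa [hedef] using hy
    have step : ∀ j : ℕ, j + 1 ≤ tm f A e → (f' ^ (j + 1)) d.1 = e.1 + (j + 1 : ℕ) := by
      intro j hj
      apply b.injective
      rw [fk', blk e j hj, hb1]; push_cast; ring
    have hp := tm_pos f A e
    refine (ret_eq_of f' A d (N e) (tm f A e) hp ?_ ?_).2
    · obtain ⟨j, hj⟩ : ∃ j, tm f A e = j + 1 := ⟨tm f A e - 1, by omega⟩
      rw [Nval, hj, step j (by omega)]
    · intro j hj0 hj1
      obtain ⟨i, rfl⟩ : ∃ i, j = i + 1 := ⟨j - 1, by omega⟩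
      rw [step i (by omega), ← fk]
      exact tm_min f A e hj0 hj1
  have hNi : N.Injective := ret_inj f A
  have hQi : Q.Injective := ret_inj f' A
  have hNt : ∀ x y, ∃ j : ℕ, N^[j] x = y := by
    intro x y
    refine ret_iter f A (y.1 - x.1).val x y ?_
    rw [fk]; simp
  have hQt : ∀ x y, ∃ j : ℕ, Q^[j] x = y := by
    intro x y
    refine ret_iter f' A (b y.1 - b x.1).val x y ?_
    apply b.injective
    rw [fk']; simp
  have hneq : ∀ x, Q x ≠ N x := by
    intro d h
    obtain ⟨e, he, hQe⟩ := cD d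
    rw [hQe] at h
    have := hNi h
    subst this
    exact (memA _).1 e.2 he
  obtain ⟨d0, hd0⟩ := hne
  have : Nonempty A := ⟨⟨d0, hd0⟩⟩
  have : Fintype A := Fintype.ofFinite A
  have hcard : Fintype.card A = D.card := by
    rw [← Nat.card_eq_fintype_card]; simp [hA]
  obtain ⟨h3, hQN⟩ := small N Q hNt hQt hQi hneq (by omega)
  refine ⟨by omega, ?_⟩
  have hconst : ∀ d : A, b (N (N d)).1 + (N d).1 = b (N d).1 + d.1 := by
    intro d
    obtain ⟨e, he, hQe⟩ := cD (N (N d))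
    rw [hQN] at hQe
    have := hNi hQe
    subst this
    have hp := tm_pos f A d
    obtain ⟨j, hj⟩ : ∃ j, tm f A d = j + 1 := ⟨tm f A d - 1, by omega⟩
    have h1 := blk d j (by omega)
    rw [← hj, ← Nval, he] at h1
    have h2 := Nval d
    rw [h1, h2, hj]; push_cast; ring
  have hs : ∀ d : A, b (N d).1 + d.1 + 1 = b (N ⟨d0, hd0⟩).1 + d0 + 1 := by
    intro d
    obtain ⟨j, rfl⟩ := hNt ⟨d0, hd0⟩ d
    induction j with
    | zero => rfl
    | succ j ih => rw [Function.iterate_succ_apply', hconst, ih]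
  set s := b (N ⟨d0, hd0⟩).1 + d0 + 1 with hsdef
  refine ⟨s, ?_, ?_⟩
  · intro x
    have hex : ∃ k : ℕ, x - (k + 1 : ℕ) ∈ A := ⟨(x - d0 - 1).val, by
      push_cast
      rw [ZMod.natCast_zmod_val]
      have h0 : x - (x - d0 - 1 + 1) = d0 := by ring
      rw [h0]; exact hd0⟩
    have hk := Nat.find_spec hex
    have hmin := fun j (hj : j < Nat.find hex) => Nat.find_min hex hj
    set k := Nat.find hex
    set d : A := ⟨x - (k + 1 : ℕ), hk⟩ with hd
    have hx : x = d.1 + (k + 1 : ℕ) := by simp [hd]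
    have hkL : k + 1 ≤ tm f A d := by
      by_contra hlt
      have hp := tm_pos f A d
      refine hmin (k - tm f A d) (by omega) ?_
      have := (N d).2
      rw [Nval] at this
      convert this using 1
      rw [hx, add_sub_assoc]
      congr 1
      have h5 : k + 1 = (k - tm f A d + 1) + tm f A d := by omega
      rw [sub_eq_iff_eq_add, ← Nat.cast_add, add_comm (tm f A d), ← h5]
    obtain ⟨j, hj⟩ := Nat.exists_eq_add_of_le hkL
    have e1 := blk d k hkL
    have e2 := blk d j (by omega)
    have e3 := blk d (k + j) (by omega)
    have e4 : (N d).1 = d.1 + (k + j + 1 : ℕ) := by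
      rw [Nval, hj]; congr 2; omega
    rw [← e4] at e3
    rw [← hx] at e1
    have hs' := hs d
    have e5 : s - b x = d.1 + (j + 1 : ℕ) := by
      rw [← hs', e3, e1]; push_cast; ring
    rw [e5, e2, ← hs', e3]
    have h7 : b (d.1 + 1) + ((k + j : ℕ) : ZMod m) + d.1 + 1 - x
        = b (d.1 + 1) + ((k + j : ℕ) : ZMod m) + d.1 + 1 - (d.1 + (k + 1 : ℕ)) := by rw [← hx]
    rw [h7]
    push_cast; ring
  · intro p hp hp1
    have h1 : N ⟨p - 1, hp1⟩ = ⟨p, hp⟩ :=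
      (ret_eq_of f A ⟨p - 1, hp1⟩ ⟨p, hp⟩ 1 one_pos (by rw [fk]; simp) (by omega)).2
    rw [← hs ⟨p - 1, hp1⟩, h1]
    ring
end Z

theorem glue {X : Type*} (β : Perm X) (A : Set X) (ρ : X → X) (hρA : ∀ a ∈ A, ρ a ∈ A)
    (hρρ : ∀ a ∈ A, ρ (ρ a) = a)
    (W : ∀ (k : ℤ), ∀ x ∈ A, ∀ y ∈ A, (β ^ k) x = y → (β ^ k) (ρ y) = ρ x)
    (hcov : ∀ x, ∃ k : ℤ, ∃ a ∈ A, (β ^ k) a = x) :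
    ∃ γ : Perm X, (∀ x, γ (γ x) = x) ∧ (∀ x, β (γ x) = γ (β⁻¹ x)) ∧ ∀ a ∈ A, γ a = ρ a := by
  choose k a ha hka using hcov
  set g : X → X := fun x => (β ^ (-k x)) (ρ (a x)) with hg
  have key : ∀ (i : ℤ), ∀ s ∈ A, g ((β ^ i) s) = (β ^ (-i)) (ρ s) := by
    intro i s hs
    have h := hka ((β ^ i) s)
    set x := (β ^ i) s with hx
    have h1 : (β ^ (i - k x)) s = a x := by
      apply (β ^ (k x)).injective
      rw [h, ← Perm.mul_apply, ← zpow_add, hx]; congr 2; ring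
    have h2 := W _ s hs (a x) (ha x) h1
    rw [← h2, ← Perm.mul_apply, ← zpow_add]
    simp only [hg]; congr 2; ring
  have hinv : ∀ x, g (g x) = x := by
    intro x
    have h1 : g x = (β ^ (-k x)) (ρ (a x)) := rfl
    rw [h1, key _ _ (hρA _ (ha x)), hρρ _ (ha x), neg_neg, hka]
  refine ⟨⟨g, g, hinv, hinv⟩, hinv, ?_, ?_⟩
  · intro x
    change β (g x) = g (β⁻¹ x)
    have h1 : β⁻¹ x = (β ^ (-1 + k x)) (a x) := by
      rw [zpow_add, Perm.mul_apply, hka]; simp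
    rw [h1, key _ _ (ha x)]
    have h1 : g x = (β ^ (-k x)) (ρ (a x)) := rfl
    rw [h1, neg_add, neg_neg, zpow_add, Perm.mul_apply, zpow_one]
  · intro s hs
    have := key 0 s hs
    simpa using this

theorem glue2 {X : Type*} (β : Perm X) (S : Set X) (ρ : X → X) (hρA : ∀ a ∈ S, ρ a ∈ S)
    (hρρ : ∀ a ∈ S, ρ (ρ a) = a)
    (W : ∀ (k : ℕ), ∀ x ∈ S, ∀ y ∈ S, (β ^ k) x = y → (β ^ k) (ρ y) = ρ x) :
    ∃ γ : Perm X, (∀ x, γ (γ x) = x) ∧ (∀ x, β (γ x) = γ (β⁻¹ x)) ∧ ∀ a ∈ S, γ a = ρ a := by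
  classical
  have WZ : ∀ (k : ℤ), ∀ x ∈ S, ∀ y ∈ S, (β ^ k) x = y → (β ^ k) (ρ y) = ρ x := by
    intro k x hx y hy h
    obtain ⟨n, rfl | rfl⟩ := k.eq_nat_or_neg
    · simpa using W n x hx y hy (by simpa using h)
    · have h1 : (β ^ n) y = x := by
        rw [← h]; simp [zpow_neg]
      have h2 := W n y hy x hx h1
      rw [← h2]; simp [zpow_neg]
  set rep : X → X := fun x => (Quotient.mk (Perm.SameCycle.setoid β) x).out with hrep
  have hrep1 : ∀ x, β.SameCycle (rep x) x := fun x => Quotient.mk_out (s := Perm.SameCycle.setoid β) x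
  have hrep2 : ∀ x y, β.SameCycle x y → rep x = rep y := by
    intro x y h
    simp only [hrep]
    congr 1
    exact Quotient.sound (s := Perm.SameCycle.setoid β) h
  set R : Set X := {x | rep x = x ∧ ∀ s ∈ S, ¬ β.SameCycle s x} with hR
  obtain ⟨γ, h1, h2, h3⟩ := glue β (S ∪ R) (fun x => if x ∈ S then ρ x else x)
    (by
      intro a ha
      by_cases h : a ∈ S
      · simp only [h, if_true]; exact Or.inl (hρA a h)
      · simp only [h, if_false]; exact ha)
    (by
      intro a ha
      by_cases h : a ∈ S
      · simp only [h, if_true, hρA a h]; exact hρρ a h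
      · simp only [h, if_false])
    (by
      intro k x hx y hy h
      have hsc : β.SameCycle x y := ⟨k, h⟩
      by_cases hxS : x ∈ S
      · by_cases hyS : y ∈ S
        · simp only [hxS, hyS, if_true]; exact WZ k x hxS y hyS h
        · exact absurd hsc ((hy.resolve_left hyS).2 x hxS)
      · by_cases hyS : y ∈ S
        · exact absurd hsc.symm ((hx.resolve_left hxS).2 y hyS)
        · simp only [hxS, hyS, if_false]
          have : x = y := by
            rw [← (hx.resolve_left hxS).1, ← (hy.resolve_left hyS).1]
            exact hrep2 _ _ hsc
          subst this
          exact h)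
    (by
      intro x
      by_cases h : ∃ s ∈ S, β.SameCycle s x
      · obtain ⟨s, hs, k, hk⟩ := h
        exact ⟨k, s, Or.inl hs, hk⟩
      · obtain ⟨k, hk⟩ := hrep1 x
        refine ⟨k, rep x, Or.inr ⟨hrep2 _ _ (hrep1 x), ?_⟩, hk⟩
        intro s hs hsc
        exact h ⟨s, hs, hsc.trans (hrep1 x)⟩)
  refine ⟨γ, h1, h2, ?_⟩
  intro a ha
  rw [h3 a (Or.inl ha), if_pos ha]

theorem param {X : Type*} [Fintype X] [DecidableEq X] (α : Perm X) (hα : α.IsCycle) :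
    ∃ (m : ℕ) (_ : NeZero m) (φ : ZMod m → X), φ.Injective ∧ (∀ i, φ (i + 1) = α (φ i)) ∧
      ∀ x, α x ≠ x ↔ ∃ i, φ i = x := by
  obtain ⟨x0, hx0, hcyc⟩ := hα
  have hα : α.IsCycle := ⟨x0, hx0, hcyc⟩
  have : NeZero (orderOf α) := ⟨(orderOf_pos α).ne'⟩
  refine ⟨orderOf α, inferInstance, fun i => (α ^ i.val) x0, ?_, ?_, ?_⟩
  · intro i j h
    have h1 : α ^ i.val = α ^ j.val := (hα.pow_eq_pow_iff).2 ⟨x0, hx0, h⟩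
    exact ZMod.val_injective _ (pow_injOn_Iio_orderOf (ZMod.val_lt i) (ZMod.val_lt j) h1)
  · intro i
    change (α ^ (i + 1).val) x0 = α ((α ^ i.val) x0)
    rw [← Perm.mul_apply, ← pow_succ', ← pow_mod_orderOf α (i.val + 1)]
    congr 2
    rw [ZMod.val_add, Nat.add_mod i.val 1, ZMod.val_one_eq_one_mod]
    simp
  · intro x
    constructor
    · intro hx
      obtain ⟨i, hi⟩ := hα.exists_pow_eq hx0 hx
      refine ⟨(i : ZMod (orderOf α)), ?_⟩
      simp only [ZMod.val_natCast, pow_mod_orderOf, hi]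
    · rintro ⟨i, rfl⟩ h
      apply hx0
      apply (α ^ i.val).injective
      rw [← Perm.mul_apply, ← pow_succ, pow_succ', Perm.mul_apply]
      exact h

/-- Proposition 4.3: if α is a cycle and the commutator [α,β] is nontrivial and
moves at most 4 points, then α and β can be simultaneously conjugated to their
inverses. -/
theorem stmt_10 {n : ℕ} (α β : Equiv.Perm (Fin n)) (hα : α.IsCycle)
    (h1 : 0 < (α⁻¹ * β⁻¹ * α * β).support.card)
    (h2 : (α⁻¹ * β⁻¹ * α * β).support.card ≤ 4) :
    ∃ γ : Equiv.Perm (Fin n), γ⁻¹ * α * γ = α⁻¹ ∧ γ⁻¹ * β * γ = β⁻¹ := by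
  classical
  obtain ⟨m, hm, φ, φinj, φα, φS⟩ := param α hα
  set C := (α⁻¹ * β⁻¹ * α * β).support with hCdef
  have hC : ∀ x, x ∈ C ↔ α (β x) ≠ β (α x) := by
    intro x
    rw [hCdef, Perm.mem_support, not_iff_not]
    simp only [Perm.mul_apply, Perm.inv_eq_iff_eq]
  have φ_ne : ∀ i, α (φ i) ≠ φ i := fun i => (φS _).2 ⟨i, rfl⟩
  set S : Set (Fin n) := Set.range φ with hS
  have memS : ∀ x, x ∈ S ↔ α x ≠ x := fun x => (φS x).symm
  have φm : ∀ i, φ i ∈ S := fun i => ⟨i, rfl⟩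
  have hb0 : ∀ i, ∃ j, φ j = (ret β S ⟨φ i, φm i⟩).1 := fun i => (ret β S ⟨φ i, φm i⟩).2
  choose b0 hb0 using hb0
  have b0inj : b0.Injective := by
    intro i j h
    have h3 := hb0 i
    rw [h, hb0 j] at h3
    have h4 := ret_inj β S (Subtype.ext h3)
    exact φinj (congrArg Subtype.val h4).symm
  obtain ⟨b, hb⟩ : ∃ b : Perm (ZMod m), ∀ i, φ (b i) = (ret β S ⟨φ i, φm i⟩).1 :=
    ⟨Equiv.ofBijective b0 (Finite.injective_iff_bijective.1 b0inj), hb0⟩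
  clear hb0 b0inj
  have hb1 : ∀ i, β (φ i) ∈ S → tm β S ⟨φ i, φm i⟩ = 1 ∧ φ (b i) = β (φ i) := by
    intro i hi
    have := ret_eq_of β S ⟨φ i, φm i⟩ ⟨β (φ i), hi⟩ 1 one_pos (by simp) (by omega)
    exact ⟨this.1, by rw [hb, this.2]⟩
  set CS : Finset (ZMod m) := Finset.univ.filter (fun i => φ i ∈ C) with hCS
  set P : Finset (ZMod m) := Finset.univ.filter (fun i => β (φ i) ∉ S) with hP
  set D : Finset (ZMod m) := Finset.univ.filter (fun i => b (i + 1) ≠ b i + 1) with hD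
  have memP : ∀ i, i ∈ P ↔ β (φ i) ∉ S := by simp [hP]
  have memCS : ∀ i, i ∈ CS ↔ α (β (φ i)) ≠ β (φ (i + 1)) := by
    intro i; simp [hCS, hC, φα]
  have PC : ∀ i ∈ P, i ∈ CS := by
    intro i hi
    rw [memP, memS, not_not] at hi
    rw [memCS, hi, φα]
    intro h
    exact φ_ne i (β.injective h).symm
  have PC' : ∀ i ∈ P, i - 1 ∈ CS := by
    intro i hi
    rw [memP, memS, not_not] at hi
    rw [memCS, sub_add_cancel]
    intro h
    rw [← hi] at h
    have h4 := β.injective (α.injective h)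
    have h5 := φα (i - 1)
    rw [sub_add_cancel, h4] at h5
    exact φ_ne i h5.symm
  have DC : D ⊆ CS := by
    intro i hi
    by_contra hc
    have hi1 : i ∉ P := fun h => hc (PC i h)
    have hi2 : i + 1 ∉ P := fun h => hc (by simpa using PC' _ h)
    rw [memP, not_not] at hi1 hi2
    rw [memCS, not_not, ← (hb1 i hi1).2, ← (hb1 _ hi2).2, ← φα] at hc
    simp only [hD, Finset.mem_filter, Finset.mem_univ, true_and] at hi
    exact hi (φinj hc).symm
  have hcard : CS.card + P.card ≤ 4 := by
    set T := Finset.univ.image φ with hT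
    have memT : ∀ x, x ∈ T ↔ x ∈ S := by intro x; simp [hT, hS]
    set T' := T.image β.symm with hT'
    have memT' : ∀ x, x ∈ T' ↔ β x ∈ S := by
      intro x
      rw [hT', Finset.mem_image]
      constructor
      · rintro ⟨y, hy, rfl⟩; simpa using (memT y).1 hy
      · intro h; exact ⟨β x, (memT _).2 h, by simp⟩
    have hTT : T.card = T'.card := by
      rw [hT', Finset.card_image_of_injective _ β.symm.injective]
    have e1 := Finset.card_sdiff_comm hTT
    have e2 : P.card = (T \ T').card := by
      rw [← Finset.card_image_of_injective P φinj]
      congr 1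
      ext x
      rw [Finset.mem_image, Finset.mem_sdiff, memT, memT']
      constructor
      · rintro ⟨i, hi, rfl⟩; exact ⟨φm i, (memP i).1 hi⟩
      · rintro ⟨⟨i, rfl⟩, h⟩; exact ⟨i, (memP i).2 h, rfl⟩
    rw [e2, e1, ← Finset.card_image_of_injective CS φinj, ← Finset.card_union_of_disjoint]
    · refine le_trans (Finset.card_le_card ?_) h2
      intro x hx
      rw [Finset.mem_union] at hx
      rcases hx with hx | hx
      · obtain ⟨i, hi, rfl⟩ := Finset.mem_image.1 hx
        simpa [hCS] using hi
      · rw [Finset.mem_sdiff, memT, memT'] at hx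
        obtain ⟨h5, h6⟩ := hx
        rw [memS] at h5 h6
        rw [not_not] at h6
        rw [hC, h6]; exact h5
    · rw [Finset.disjoint_left]
      intro x hx hx'
      obtain ⟨i, hi, rfl⟩ := Finset.mem_image.1 hx
      rw [Finset.mem_sdiff, memT] at hx'
      exact hx'.2 (φm i)
  obtain ⟨s, hs, hsP⟩ : ∃ s, (∀ x, b (s - b x) = s - x) ∧ ∀ p ∈ P, s = p + b p := by
    have hDle := Finset.card_le_card DC
    rcases D.eq_empty_or_nonempty with hDe | hDn
    · have hadd : ∀ i, b (i + 1) = b i + 1 := by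
        intro i
        by_contra h
        have : i ∈ D := by simp [hD, h]
        rw [hDe] at this
        simp at this
      have htr : ∀ i, b i = i + b 0 := by
        intro i
        have : ∀ k : ℕ, b (k : ZMod m) = k + b 0 := by
          intro k
          induction k with
          | zero => simp
          | succ k ih => push_cast; rw [hadd, ih]; ring
        have h := this i.val
        rwa [ZMod.natCast_zmod_val] at h
      have hall : ∀ s x, b (s - b x) = s - x := by
        intro s x
        rw [htr (s - b x), htr x]; ring
      rcases P.eq_empty_or_nonempty with hPe | ⟨p, hp⟩
      · exact ⟨0, hall 0, by simp [hPe]⟩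
      · refine ⟨p + b p, hall _, ?_⟩
        intro q hq
        by_cases hpq : p = q
        · rw [hpq]
        have hP2 : ({p, q} : Finset (ZMod m)) ⊆ P := by
          intro x hx
          simp only [Finset.mem_insert, Finset.mem_singleton] at hx
          rcases hx with rfl | rfl <;> assumption
        have hPCS : P ⊆ CS := fun i hi => PC i hi
        have c1 := Finset.card_le_card hP2
        rw [Finset.card_pair hpq] at c1
        have c2 := Finset.card_le_card hPCS
        have hEq : ({p, q} : Finset (ZMod m)) = CS :=
          Finset.eq_of_subset_of_card_le (hP2.trans hPCS) (by rw [Finset.card_pair hpq]; omega)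
        have n10 : (1 : ZMod m) ≠ 0 := by
          intro h
          have := φα 0
          rw [h, add_zero] at this
          exact φ_ne 0 this.symm
        have u := PC' p hp
        have v := PC' q hq
        rw [← hEq] at u v
        simp only [Finset.mem_insert, Finset.mem_singleton] at u v
        have u' : p - 1 = q := u.resolve_left (fun h => n10 (by simpa using h))
        have v' : q - 1 = p := v.resolve_right (fun h => n10 (by simpa using h))
        rw [htr p, htr q]
        linear_combination u' - v'
    · obtain ⟨h3, s, hs, hsp⟩ := zlemma b D (by simp [hD]) hDn (by omega)
      refine ⟨s, hs, ?_⟩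
      intro p hp
      have hp1 : 0 < P.card := Finset.card_pos.2 ⟨p, hp⟩
      have hEq : D = CS := Finset.eq_of_subset_of_card_le DC (by omega)
      exact hsp p (hEq ▸ PC p hp) (hEq ▸ PC' p hp)
  have hρ : ∃ ρ : Fin n → Fin n, ∀ i, ρ (φ i) = φ (s - i) :=
    ⟨Function.extend φ (fun i => φ (s - i)) id, fun i => φinj.extend_apply _ _ i⟩
  obtain ⟨ρ, hρ⟩ := hρ
  have W : ∀ (k : ℕ) (i j : ZMod m), (β ^ k) (φ i) = φ j → (β ^ k) (φ (s - j)) = φ (s - i) := by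
    intro k
    induction k using Nat.strong_induction_on with
    | _ k ih =>
      intro i j h
      rcases Nat.eq_zero_or_pos k with h0 | h0
      · subst h0
        rw [φinj (by simpa using h : φ i = φ j)]
        simp
      · have hp := tm_pos β S ⟨φ i, φm i⟩
        have hle := tm_le β S ⟨φ i, φm i⟩ h0 (by rw [h]; exact φm j)
        have hbi := hb i
        rw [ret_val] at hbi
        have hstep : (β ^ (tm β S ⟨φ i, φm i⟩)) (φ (s - b i)) = φ (s - i) := by
          by_cases hiP : i ∈ P
          · have h5 := hsP i hiP
            have h6 : s - b i = i := by rw [h5]; ring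
            have h7 : s - i = b i := by rw [h5]; ring
            rw [h6, h7, hbi]
          · have h5 := hb1 i (by simpa [memP] using hiP)
            rw [h5.1, pow_one]
            have hjP : s - b i ∉ P := by
              intro hj
              have h6 := hsP _ hj
              rw [hs] at h6
              apply hiP
              have h7 : s - b i = i := by linear_combination -h6
              rwa [h7] at hj
            have h6 := hb1 (s - b i) (by simpa [memP] using hjP)
            rw [← h6.2, hs]
        set t := tm β S ⟨φ i, φm i⟩ with ht
        have h8 := ih (k - t) (by omega) (b i) j (by
          rw [hbi, ← Perm.mul_apply, ← pow_add, Nat.sub_add_cancel hle, h])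
        have h9 : k = t + (k - t) := by omega
        rw [h9, pow_add, Perm.mul_apply, h8, hstep]
  obtain ⟨γ, hγγ, hγβ, hγS⟩ := glue2 β S ρ
    (by rintro _ ⟨i, rfl⟩; rw [hρ]; exact φm _)
    (by rintro _ ⟨i, rfl⟩; rw [hρ, hρ]; congr 1; ring)
    (by
      rintro k _ ⟨i, rfl⟩ _ ⟨j, rfl⟩ h
      rw [hρ, hρ]; exact W k i j h)
  have hγφ : ∀ i, γ (φ i) = φ (s - i) := fun i => by rw [hγS _ (φm i), hρ]
  refine ⟨γ, ?_, ?_⟩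
  · rw [mul_assoc, inv_mul_eq_iff_eq_mul]
    ext1 x
    rw [Perm.mul_apply, Perm.mul_apply]
    by_cases hx : x ∈ S
    · obtain ⟨i, rfl⟩ := hx
      have h5 : α⁻¹ (φ i) = φ (i - 1) := by
        rw [Perm.inv_eq_iff_eq, ← φα, sub_add_cancel]
      rw [h5, hγφ, hγφ, ← φα]
      congr 1; ring
    · have hγx : γ x ∉ S := by
        rintro ⟨i, hi⟩
        apply hx
        rw [← hγγ x, ← hi, hγφ]
        exact φm _
      rw [memS, not_not] at hx hγx
      have h5 : α⁻¹ x = x := by rw [Perm.inv_eq_iff_eq, hx]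
      rw [h5, hγx]
  · rw [mul_assoc, inv_mul_eq_iff_eq_mul]
    ext1 x
    rw [Perm.mul_apply, Perm.mul_apply, hγβ]
end

section
/- Let α = α₁α₂ be a product of two disjoint nontrivial cycles in S_n and β ∈ S_n such that 0 < |M([α,β])| ≤ 4 and β⁻¹α_iβ ∉ {α₁, α₂} for i = 1,2. Then there exists γ ∈ S_n such that γ⁻¹α₁γ = α₁⁻¹, γ⁻¹α₂γ = α₂⁻¹, and γ⁻¹βγ = β⁻¹. -/
/-- A labelled self-map of a small set, whose labels `0`, `1` are orbits and label `2` is fixed. -/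
def HP {m : ℕ} (p : Fin m → Fin m) (s : Fin m → Fin 3) : Prop :=
  (∀ x, s (p x) = s x) ∧ (∀ x, s x = 2 → p x = x) ∧
    (∀ x y, s x = s y → s x ≠ 2 → (y = x ∨ y = p x ∨ y = p (p x) ∨ y = p (p (p x))))

instance {m : ℕ} (p : Fin m → Fin m) (s : Fin m → Fin 3) : Decidable (HP p s) := by
  unfold HP; infer_instance

/-- The combinatorial shadow of the length constraints. -/
def HL {m : ℕ} (s t : Fin m → Fin 3) : Prop :=
  (∀ e, s e = 2 → t e ≠ 2) ∧
  (∀ i : Fin 3, i ≠ 2 → (∃ e, t e = i) ∧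
    ((∀ e, s e = i → t e = i) → (∀ e, t e = i → s e = i)) ∧
    ((∀ e, t e = i → s e = i) → (∀ e, s e = i → t e = i)) ∧
    (∀ e, s e = i → (∀ e', s e' = i → e' = e) → t e ≠ 2) ∧
    (∀ e, t e = i → (∀ e', t e' = i → e' = e) → s e ≠ 2)) ∧
  (∑ e, if s e = 2 then 1 else 0) = (∑ e, if t e = 2 then 1 else 0)

instance {m : ℕ} (s t : Fin m → Fin 3) : Decidable (HL s t) := by
  unfold HL; infer_instance

/-- Certificate that two blocks have equal length. -/
def HE {m : ℕ} (s t : Fin m → Fin 3) (x y : Fin m) : Prop :=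
  x = y ∨ ((s x = 2 ∨ t x = 2) ∧ (s y = 2 ∨ t y = 2)) ∨
  ∃ i : Fin 3, i ≠ 2 ∧ (∀ z, z ≠ x → z ≠ y → (s z = i ↔ t z = i)) ∧
    ((s x = i ∧ t x ≠ i ∧ s y ≠ i ∧ t y = i) ∨ (s x ≠ i ∧ t x = i ∧ s y = i ∧ t y ≠ i))

instance {m : ℕ} (s t : Fin m → Fin 3) (x y : Fin m) : Decidable (HE s t x y) := by
  unfold HE; infer_instance

/-- The required block involution. -/
def HC {m : ℕ} (p q r : Fin m → Fin m) (s t : Fin m → Fin 3) : Prop :=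
  (∀ e, s (r e) = t e) ∧ (∀ e, r (r e) = e) ∧ (∀ e, p (r (q e)) = r e) ∧
  (∀ e, HE s t e (r e)) ∧ (∀ e e', s e = 2 → s e' = 2 → e = e')

instance {m : ℕ} (p q r : Fin m → Fin m) (s t : Fin m → Fin 3) : Decidable (HC p q r s t) := by
  unfold HC; infer_instance

set_option maxRecDepth 100000 in
set_option synthInstance.maxSize 100000 in
set_option synthInstance.maxHeartbeats 2000000 in
set_option maxHeartbeats 4000000 in
lemma dec4 : ∀ s0 s1 s2 s3 : Fin 3, s0 = 0 → s0 ≤ s1 → s1 ≤ s2 → s2 ≤ s3 →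
    (s1 = 1 ∨ s2 = 1 ∨ s3 = 1) →
    ∀ p0 : Fin 4, ∀ p1, p1 ≠ p0 → ∀ p2, p2 ≠ p0 → p2 ≠ p1 → ∀ p3, p3 ≠ p0 → p3 ≠ p1 → p3 ≠ p2 →
    HP ![p0, p1, p2, p3] ![s0, s1, s2, s3] →
    ∀ q0, q0 ≠ p0 → ∀ q1, q1 ≠ p1 → q1 ≠ q0 → ∀ q2, q2 ≠ p2 → q2 ≠ q0 → q2 ≠ q1 →
    ∀ q3, q3 ≠ p3 → q3 ≠ q0 → q3 ≠ q1 → q3 ≠ q2 →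
    ∀ t0 t1 t2 t3, HP ![q0, q1, q2, q3] ![t0, t1, t2, t3] →
    HL ![s0, s1, s2, s3] ![t0, t1, t2, t3] →
    ∃ r0, ![s0, s1, s2, s3] r0 = t0 ∧ ∃ r1, ![s0, s1, s2, s3] r1 = t1 ∧
    ∃ r2, ![s0, s1, s2, s3] r2 = t2 ∧ ∃ r3, ![s0, s1, s2, s3] r3 = t3 ∧
    HC ![p0, p1, p2, p3] ![q0, q1, q2, q3] ![r0, r1, r2, r3] ![s0, s1, s2, s3] ![t0, t1, t2, t3] := by
  decide +kernel

set_option maxRecDepth 100000 in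
set_option synthInstance.maxSize 100000 in
set_option synthInstance.maxHeartbeats 2000000 in
set_option maxHeartbeats 4000000 in
lemma dec3 : ∀ s0 s1 s2 : Fin 3, s0 = 0 → s0 ≤ s1 → s1 ≤ s2 →
    (s1 = 1 ∨ s2 = 1) →
    ∀ p0 : Fin 3, ∀ p1, p1 ≠ p0 → ∀ p2, p2 ≠ p0 → p2 ≠ p1 →
    HP ![p0, p1, p2] ![s0, s1, s2] →
    ∀ q0, q0 ≠ p0 → ∀ q1, q1 ≠ p1 → q1 ≠ q0 → ∀ q2, q2 ≠ p2 → q2 ≠ q0 → q2 ≠ q1 →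
    ∀ t0 t1 t2, HP ![q0, q1, q2] ![t0, t1, t2] →
    HL ![s0, s1, s2] ![t0, t1, t2] →
    ∃ r0, ![s0, s1, s2] r0 = t0 ∧ ∃ r1, ![s0, s1, s2] r1 = t1 ∧
    ∃ r2, ![s0, s1, s2] r2 = t2 ∧
    HC ![p0, p1, p2] ![q0, q1, q2] ![r0, r1, r2] ![s0, s1, s2] ![t0, t1, t2] := by
  decide +kernel

lemma dec2 : ∀ s0 s1 : Fin 3, s0 = 0 → s1 = 1 →
    ∀ p0 p1 : Fin 2, HP ![p0, p1] ![s0, s1] →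
    ∀ q0, q0 ≠ p0 → ∀ q1, q1 ≠ p1 → 
    ∀ t0 t1, HP ![q0, q1] ![t0, t1] → ¬ HL ![s0, s1] ![t0, t1] := by
  decide +kernel

lemma finDec {m : ℕ} (hm : m ≤ 4) (p q : Fin m → Fin m) (s t : Fin m → Fin 3)
    (hs : Monotone s) (hp : Function.Injective p) (hq : Function.Injective q)
    (hpq : ∀ e, q e ≠ p e) (hps : HP p s) (hqt : HP q t) (hl : HL s t)
    (h0 : ∃ e, s e = 0) (h1 : ∃ e, s e = 1) : ∃ r, HC p q r s t := by
  interval_cases m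
  · exact h0.choose.elim0
  · obtain ⟨a, ha⟩ := h0
    obtain ⟨b, hb⟩ := h1
    rw [Subsingleton.elim a b, hb] at ha
    exact absurd ha (by decide)
  · have es : s = ![s 0, s 1] := by funext i; fin_cases i <;> rfl
    have et : t = ![t 0, t 1] := by funext i; fin_cases i <;> rfl
    have ep : p = ![p 0, p 1] := by funext i; fin_cases i <;> rfl
    have eq : q = ![q 0, q 1] := by funext i; fin_cases i <;> rfl
    have m1 : s 0 ≤ s 1 := hs (by decide)
    rw [es, et] at hl
    rw [es, ep] at hps
    rw [et, eq] at hqt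
    have h0' : s 0 = 0 ∨ s 1 = 0 := by
      obtain ⟨e, he⟩ := h0; fin_cases e
      exacts [Or.inl he, Or.inr he]
    have h1' : s 0 = 1 ∨ s 1 = 1 := by
      obtain ⟨e, he⟩ := h1; fin_cases e
      exacts [Or.inl he, Or.inr he]
    have a0 : s 0 = 0 := by omega
    have a1 : s 1 = 1 := by omega
    exact absurd hl (dec2 _ _ a0 a1 _ _ hps _ (hpq 0) _ (hpq 1) _ _ hqt)
  · have es : s = ![s 0, s 1, s 2] := by funext i; fin_cases i <;> rfl
    have et : t = ![t 0, t 1, t 2] := by funext i; fin_cases i <;> rfl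
    have ep : p = ![p 0, p 1, p 2] := by funext i; fin_cases i <;> rfl
    have eq : q = ![q 0, q 1, q 2] := by funext i; fin_cases i <;> rfl
    have m1 : s 0 ≤ s 1 := hs (by decide)
    have m2 : s 1 ≤ s 2 := hs (by decide)
    rw [es, et] at hl
    rw [es, ep] at hps
    rw [et, eq] at hqt
    have h0' : s 0 = 0 ∨ s 1 = 0 ∨ s 2 = 0 := by
      obtain ⟨e, he⟩ := h0; fin_cases e
      exacts [Or.inl he, Or.inr (Or.inl he), Or.inr (Or.inr he)]
    have h1' : s 0 = 1 ∨ s 1 = 1 ∨ s 2 = 1 := by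
      obtain ⟨e, he⟩ := h1; fin_cases e
      exacts [Or.inl he, Or.inr (Or.inl he), Or.inr (Or.inr he)]
    have a0 : s 0 = 0 := by omega
    obtain ⟨r0, -, r1, -, r2, -, h⟩ := dec3 _ _ _ a0 m1 m2 (by omega) _ _
      (hp.ne (by decide)) _ (hp.ne (by decide)) (hp.ne (by decide)) hps
      _ (hpq 0) _ (hpq 1) (hq.ne (by decide)) _ (hpq 2) (hq.ne (by decide)) (hq.ne (by decide))
      _ _ _ hqt hl
    rw [es, et, ep, eq]
    exact ⟨_, h⟩
  · have es : s = ![s 0, s 1, s 2, s 3] := by funext i; fin_cases i <;> rfl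
    have et : t = ![t 0, t 1, t 2, t 3] := by funext i; fin_cases i <;> rfl
    have ep : p = ![p 0, p 1, p 2, p 3] := by funext i; fin_cases i <;> rfl
    have eq : q = ![q 0, q 1, q 2, q 3] := by funext i; fin_cases i <;> rfl
    have m1 : s 0 ≤ s 1 := hs (by decide)
    have m2 : s 1 ≤ s 2 := hs (by decide)
    have m3 : s 2 ≤ s 3 := hs (by decide)
    rw [es, et] at hl
    rw [es, ep] at hps
    rw [et, eq] at hqt
    have h0' : s 0 = 0 ∨ s 1 = 0 ∨ s 2 = 0 ∨ s 3 = 0 := by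
      obtain ⟨e, he⟩ := h0; fin_cases e
      exacts [Or.inl he, Or.inr (Or.inl he), Or.inr (Or.inr (Or.inl he)), Or.inr (Or.inr (Or.inr he))]
    have h1' : s 0 = 1 ∨ s 1 = 1 ∨ s 2 = 1 ∨ s 3 = 1 := by
      obtain ⟨e, he⟩ := h1; fin_cases e
      exacts [Or.inl he, Or.inr (Or.inl he), Or.inr (Or.inr (Or.inl he)), Or.inr (Or.inr (Or.inr he))]
    have a0 : s 0 = 0 := by omega
    obtain ⟨r0, -, r1, -, r2, -, r3, -, h⟩ := dec4 _ _ _ _ a0 m1 m2 m3 (by omega) _ _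
      (hp.ne (by decide)) _ (hp.ne (by decide)) (hp.ne (by decide))
      _ (hp.ne (by decide)) (hp.ne (by decide)) (hp.ne (by decide)) hps
      _ (hpq 0) _ (hpq 1) (hq.ne (by decide)) _ (hpq 2) (hq.ne (by decide)) (hq.ne (by decide))
      _ (hpq 3) (hq.ne (by decide)) (hq.ne (by decide)) (hq.ne (by decide))
      _ _ _ _ hqt hl
    rw [es, et, ep, eq]
    exact ⟨_, h⟩

lemma iter_small {m : ℕ} (hm : m ≤ 4) (p : Fin m → Fin m) (hp : Function.Injective p)
    (x y : Fin m) (h : ∃ j, p^[j] x = y) :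
    y = x ∨ y = p x ∨ y = p (p x) ∨ y = p (p (p x)) := by
  obtain ⟨j, rfl⟩ := h
  have hx : x ∈ Function.periodicPts p := hp.mem_periodicPts x
  have hpos := Function.minimalPeriod_pos_of_mem_periodicPts hx
  have hle : Function.minimalPeriod p x ≤ m := by
    have := Function.minimalPeriod_le_card (f := p) (x := x)
    simpa using this
  rw [← Function.iterate_mod_minimalPeriod_eq (f := p) (x := x) (n := j)]
  have hlt := Nat.mod_lt j hpos
  generalize j % Function.minimalPeriod p x = i at hlt
  have : i < 4 := by omega
  interval_cases i <;> simp

lemma finSorted {m : ℕ} (hm : m ≤ 4) (p q : Fin m → Fin m) (s t : Fin m → Fin 3) (ℓ : Fin m → ℕ)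
    (hs : Monotone s)
    (hp : Function.Injective p) (hq : Function.Injective q)
    (sp : ∀ e, s (p e) = s e) (tq : ∀ e, t (q e) = t e)
    (hpq : ∀ e, q e ≠ p e) (st : ∀ e, s e = 2 → t e ≠ 2)
    (s2 : ∀ e, s e = 2 → p e = e) (t2 : ∀ e, t e = 2 → q e = e)
    (ls : ∀ e, s e = 2 → ℓ e = 1) (lt : ∀ e, t e = 2 → ℓ e = 1) (l1 : ∀ e, 1 ≤ ℓ e)
    (trs : ∀ x y, s x = s y → s x ≠ 2 → ∃ j, p^[j] x = y)
    (trt : ∀ x y, t x = t y → t x ≠ 2 → ∃ j, q^[j] x = y)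
    (exs : ∀ i, i ≠ 2 → ∃ e, s e = i) (ext : ∀ i, i ≠ 2 → ∃ e, t e = i)
    (hsum : ∀ i, i ≠ 2 → ∑ e with s e = i, ℓ e = ∑ e with t e = i, ℓ e)
    (hsum2 : ∀ i, i ≠ 2 → 2 ≤ ∑ e with s e = i, ℓ e) :
    ∃ r : Fin m → Fin m, (∀ e, r (r e) = e) ∧ (∀ e, p (r (q e)) = r e) ∧ (∀ e, s (r e) = t e) ∧
      (∀ e, ℓ (r e) = ℓ e) ∧ (∀ e e', s e = 2 → s e' = 2 → e = e') := by
  have hsub : ∀ (u v : Fin m → Fin 3) (i : Fin 3),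
      ∑ e with u e = i, ℓ e = ∑ e with v e = i, ℓ e →
      (∀ e, u e = i → v e = i) → (∀ e, v e = i → u e = i) := by
    intro u v i huv h e he
    by_contra hne
    have : ∑ e with u e = i, ℓ e < ∑ e with v e = i, ℓ e := by
      apply Finset.sum_lt_sum_of_subset (i := e)
      · intro x hx; simp at hx ⊢; exact h x hx
      · simpa using he
      · simpa using hne
      · exact l1 e
      · intros; omega
    omega
  have htwo : ∑ e with s e = 2, ℓ e = ∑ e with t e = 2, ℓ e := by
    have a := Finset.sum_fiberwise (Finset.univ) s ℓ
    have b := Finset.sum_fiberwise (Finset.univ) t ℓ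
    rw [Fin.sum_univ_three] at a b
    have c0 := hsum 0 (by decide)
    have c1 := hsum 1 (by decide)
    omega
  have hsing : ∀ (u : Fin m → Fin 3) (i : Fin 3), 2 ≤ ∑ e with u e = i, ℓ e →
      ∀ e, u e = i → (∀ e', u e' = i → e' = e) → ℓ e ≠ 1 := by
    intro u i hu e he h h1
    have : (Finset.univ.filter fun e => u e = i) = {e} := by
      ext x; simp; constructor
      · exact h x
      · rintro rfl; exact he
    rw [this, Finset.sum_singleton] at hu
    omega
  have hl : HL s t := by
    refine ⟨st, ?_, ?_⟩
    · intro i hi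
      refine ⟨ext i hi, hsub s t i (hsum i hi), hsub t s i (hsum i hi).symm, ?_, ?_⟩
      · intro e he h h2
        exact hsing s i (hsum2 i hi) e he h (lt e h2)
      · intro e he h h2
        exact hsing t i (hsum i hi ▸ hsum2 i hi) e he h (ls e h2)
    · rw [Finset.sum_filter, Finset.sum_filter] at htwo
      rw [Finset.sum_congr rfl (g := fun e => if s e = 2 then ℓ e else 0)
        (fun e _ => by split_ifs with h <;> simp [ls, h]),
        Finset.sum_congr rfl (f := fun e => if t e = 2 then 1 else 0)
          (g := fun e => if t e = 2 then ℓ e else 0)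
        (fun e _ => by split_ifs with h <;> simp [lt, h])]
      exact htwo
  obtain ⟨r, hr1, hr2, hr3, hr4, hr5⟩ := finDec hm p q s t hs hp hq hpq
    ⟨sp, s2, fun x y h h' => iter_small hm p hp x y (trs x y h h')⟩
    ⟨tq, t2, fun x y h h' => iter_small hm q hq x y (trt x y h h')⟩ hl
    (exs 0 (by decide)) (exs 1 (by decide))
  refine ⟨r, hr2, hr3, hr1, ?_, hr5⟩
  intro e
  rcases hr4 e with h | ⟨h, h'⟩ | ⟨i, hi, hz, h⟩
  · rw [← h]
  · have a : ℓ e = 1 := h.elim (ls e) (lt e)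
    have b : ℓ (r e) = 1 := h'.elim (ls _) (lt _)
    omega
  · have hne : e ≠ r e := by
      intro h'; rw [← h'] at h; tauto
    have key := hsum i hi
    have hsplit : ∀ g : Fin m → ℕ, ∑ x, g x =
        g e + (g (r e) + ∑ x ∈ (Finset.univ.erase e).erase (r e), g x) := by
      intro g
      rw [Finset.add_sum_erase (Finset.univ.erase e) g (by simp [hne.symm]),
        Finset.add_sum_erase _ _ (Finset.mem_univ e)]
    rw [Finset.sum_filter, Finset.sum_filter, hsplit, hsplit] at key
    have hrest : ∑ x ∈ (Finset.univ.erase e).erase (r e), (if s x = i then ℓ x else 0) =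
        ∑ x ∈ (Finset.univ.erase e).erase (r e), (if t x = i then ℓ x else 0) := by
      apply Finset.sum_congr rfl
      intro x hx
      simp at hx
      simp [hz x hx.2 hx.1]
    rw [hrest] at key
    rcases h with ⟨a, b, c, d⟩ | ⟨a, b, c, d⟩ <;> simp [a, b, c, d] at key <;> omega

lemma finMain {D : Type*} [Fintype D] [DecidableEq D] (hm : Fintype.card D ≤ 4)
    (p q : D → D) (s t : D → Fin 3) (ℓ : D → ℕ)
    (hp : Function.Injective p) (hq : Function.Injective q)
    (sp : ∀ e, s (p e) = s e) (tq : ∀ e, t (q e) = t e)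
    (hpq : ∀ e, q e ≠ p e) (st : ∀ e, s e = 2 → t e ≠ 2)
    (s2 : ∀ e, s e = 2 → p e = e) (t2 : ∀ e, t e = 2 → q e = e)
    (ls : ∀ e, s e = 2 → ℓ e = 1) (lt : ∀ e, t e = 2 → ℓ e = 1) (l1 : ∀ e, 1 ≤ ℓ e)
    (trs : ∀ x y, s x = s y → s x ≠ 2 → ∃ j, p^[j] x = y)
    (trt : ∀ x y, t x = t y → t x ≠ 2 → ∃ j, q^[j] x = y)
    (exs : ∀ i, i ≠ 2 → ∃ e, s e = i) (ext : ∀ i, i ≠ 2 → ∃ e, t e = i)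
    (hsum : ∀ i, i ≠ 2 → ∑ e with s e = i, ℓ e = ∑ e with t e = i, ℓ e)
    (hsum2 : ∀ i, i ≠ 2 → 2 ≤ ∑ e with s e = i, ℓ e) :
    ∃ r : D → D, (∀ e, r (r e) = e) ∧ (∀ e, p (r (q e)) = r e) ∧ (∀ e, s (r e) = t e) ∧
      (∀ e, ℓ (r e) = ℓ e) ∧ (∀ e e', s e = 2 → s e' = 2 → e = e') := by
  obtain ⟨f, hf⟩ : ∃ f : Fin (Fintype.card D) ≃ D, Monotone (s ∘ f) := by
    let f0 := (Fintype.equivFin D).symm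
    exact ⟨(Tuple.sort (s ∘ f0)).trans f0, Tuple.monotone_sort (s ∘ f0)⟩
  have hit : ∀ (g : D → D) (j : ℕ) (x : Fin (Fintype.card D)),
      (fun x => f.symm (g (f x)))^[j] x = f.symm (g^[j] (f x)) := by
    intro g j
    induction j with
    | zero => simp
    | succ j ih => intro x; rw [Function.iterate_succ_apply, ih, Function.iterate_succ_apply]; simp
  have hsm : ∀ (u : D → Fin 3) (i : Fin 3),
      ∑ e with u (f e) = i, ℓ (f e) = ∑ e with u e = i, ℓ e := by
    intro u i
    rw [Finset.sum_filter, Finset.sum_filter]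
    exact Equiv.sum_comp f (fun e => if u e = i then ℓ e else 0)
  obtain ⟨r, h1, h2, h3, h4, h5⟩ := finSorted hm (fun x => f.symm (p (f x)))
    (fun x => f.symm (q (f x))) (s ∘ f) (t ∘ f) (ℓ ∘ f) hf
    (fun x y h => by simpa [hp.eq_iff] using h) (fun x y h => by simpa [hq.eq_iff] using h)
    (by simp [sp]) (by simp [tq]) (by simp [hpq]) (fun e => st _)
    (fun e h => by simp [s2 (f e) h]) (fun e h => by simp [t2 (f e) h])
    (fun e => ls _) (fun e => lt _) (fun e => l1 _)
    (fun x y h h' => by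
      obtain ⟨j, hj⟩ := trs (f x) (f y) h h'
      exact ⟨j, by rw [hit, hj]; simp⟩)
    (fun x y h h' => by
      obtain ⟨j, hj⟩ := trt (f x) (f y) h h'
      exact ⟨j, by rw [hit, hj]; simp⟩)
    (fun i hi => by obtain ⟨e, he⟩ := exs i hi; exact ⟨f.symm e, by simp [he]⟩)
    (fun i hi => by obtain ⟨e, he⟩ := ext i hi; exact ⟨f.symm e, by simp [he]⟩)
    (fun i hi => by simpa [hsm] using hsum i hi)
    (fun i hi => by simpa [hsm] using hsum2 i hi)
  refine ⟨fun e => f (r (f.symm e)), ?_, ?_, ?_, ?_, ?_⟩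
  · intro e; simp [h1]
  · intro e
    have := h2 (f.symm e)
    simp at this
    simpa using congrArg f this
  · intro e; simpa using h3 (f.symm e)
  · intro e; simpa using h4 (f.symm e)
  · intro e e' h h'
    simpa using h5 (f.symm e) (f.symm e') (by simpa using h) (by simpa using h')

open Equiv

section Blocks

variable {X : Type*}

/-- Number of steps to the end of the block of `x`. -/
noncomputable def bk (α : Perm X) (D : Set X) (x : X) : ℕ := sInf {j | (α ^ j) x ∈ D}

/-- The end of the block of `x`. -/
noncomputable def bE (α : Perm X) (D : Set X) (x : X) : X := (α ^ bk α D x) x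

/-- The length of the block with end `e`. -/
noncomputable def bl (α : Perm X) (D : Set X) (e : X) : ℕ :=
  sInf {j | 1 ≤ j ∧ (α ^ j)⁻¹ e ∈ D}

/-- `x` lies in an orbit meeting `D`. -/
def InO (α : Perm X) (D : Set X) (x : X) : Prop := ∃ j : ℕ, (α ^ j) x ∈ D

variable (α : Perm X) (D : Set X)

lemma bl_spec [Finite X] {e : X} (he : e ∈ D) : 1 ≤ bl α D e ∧ (α ^ bl α D e)⁻¹ e ∈ D := by
  apply Nat.sInf_mem (s := {j | 1 ≤ j ∧ (α ^ j)⁻¹ e ∈ D})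
  exact ⟨orderOf α, orderOf_pos α, by rw [pow_orderOf_eq_one]; simpa using he⟩

lemma bl_min {e : X} {j : ℕ} (h1 : 1 ≤ j) (h2 : j < bl α D e) : (α ^ j)⁻¹ e ∉ D := by
  intro h
  exact Nat.notMem_of_lt_sInf h2 ⟨h1, h⟩

lemma bl_le {e : X} {j : ℕ} (h1 : 1 ≤ j) (h : (α ^ j)⁻¹ e ∈ D) : bl α D e ≤ j :=
  Nat.sInf_le ⟨h1, h⟩

lemma bE_mem {x : X} (h : InO α D x) : bE α D x ∈ D :=
  Nat.sInf_mem (s := {j | (α ^ j) x ∈ D}) h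

lemma pow_inv_shift (i j : ℕ) (hij : i ≤ j) (e : X) :
    (α ^ i) ((α ^ j)⁻¹ e) = (α ^ (j - i))⁻¹ e := by
  rw [Perm.eq_inv_iff_eq, ← Perm.mul_apply, ← pow_add, Nat.sub_add_cancel hij]
  simp

lemma pow_inv_shift' (i j : ℕ) (hij : i ≤ j) (e : X) :
    (α ^ i)⁻¹ ((α ^ j) e) = (α ^ (j - i)) e := by
  rw [Perm.inv_eq_iff_eq, ← Perm.mul_apply, ← pow_add, Nat.add_sub_cancel' hij]

lemma bk_inv {e : X} {j : ℕ} (he : e ∈ D) (hj : j < bl α D e) : bk α D ((α ^ j)⁻¹ e) = j := by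
  apply le_antisymm
  · apply Nat.sInf_le
    simpa using he
  · by_contra hlt
    push Not at hlt
    have hmem : (α ^ bk α D ((α ^ j)⁻¹ e)) ((α ^ j)⁻¹ e) ∈ D :=
      bE_mem α D ⟨j, by simpa using he⟩
    rw [pow_inv_shift α _ _ hlt.le] at hmem
    exact bl_min α D (by omega) (by omega) hmem

lemma bE_inv {e : X} {j : ℕ} (he : e ∈ D) (hj : j < bl α D e) : bE α D ((α ^ j)⁻¹ e) = e := by
  unfold bE
  rw [bk_inv α D he hj]; simp

lemma bk_lt [Finite X] {x : X} (h : InO α D x) : bk α D x < bl α D (bE α D x) := by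
  by_contra hle
  push Not at hle
  obtain ⟨h1, h2⟩ := bl_spec α D (bE_mem α D h)
  have h3 : (α ^ bl α D (bE α D x))⁻¹ ((α ^ bk α D x) x) ∈ D := h2
  rw [pow_inv_shift' α _ _ hle] at h3
  have : bk α D x ≤ bk α D x - bl α D (bE α D x) := Nat.sInf_le h3
  omega

lemma eq_inv_bE (x : X) : (α ^ bk α D x)⁻¹ (bE α D x) = x := by
  unfold bE; simp

lemma bk_mem {x : X} (h : x ∈ D) : bk α D x = 0 := by
  have : bk α D x ≤ 0 := Nat.sInf_le (by simpa using h)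
  omega

lemma bE_self {x : X} (h : x ∈ D) : bE α D x = x := by
  unfold bE; rw [bk_mem α D h]; simp

lemma InO_of_mem {x : X} (h : x ∈ D) : InO α D x := ⟨0, by simpa using h⟩

lemma InO_inv {e : X} (he : e ∈ D) (j : ℕ) : InO α D ((α ^ j)⁻¹ e) := ⟨j, by simpa using he⟩

/-- predecessor of a block end -/
noncomputable def bp (e : X) : X := (α ^ bl α D e)⁻¹ e

lemma bp_inj [Finite X] {e e' : X} (he : e ∈ D) (he' : e' ∈ D) (h : bp α D e = bp α D e') :
    e = e' := by
  have main : ∀ e e' : X, e ∈ D → e' ∈ D → bp α D e = bp α D e' →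
      bl α D e < bl α D e' → False := by
    intro e e' he he' h hlt
    have h1 : (α ^ bl α D e) (bp α D e) = e := by unfold bp; simp
    rw [h] at h1
    unfold bp at h1
    rw [pow_inv_shift α _ _ hlt.le] at h1
    have h2 := (bl_spec α D he).1
    exact bl_min α D (e := e') (j := bl α D e' - bl α D e) (by omega) (by omega)
      (by rw [h1]; exact he)
  rcases lt_trichotomy (bl α D e) (bl α D e') with hlt | heq | hlt
  · exact (main _ _ he he' h hlt).elim
  · unfold bp at h
    rw [heq] at h
    exact (Equiv.injective _) h
  · exact (main _ _ he' he h.symm hlt).elim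

/-- card of a union of blocks -/
lemma card_blocks [Fintype X] [DecidableEq X] [Fintype D] (u : X → Fin 3) (i : Fin 3)
    (hO : ∀ x, u x = i → InO α D x)
    (hu : ∀ x, InO α D x → u (bE α D x) = u x) :
    (Finset.univ.filter fun x => u x = i).card = ∑ e ∈ (Finset.univ : Finset D).filter (fun e => u e.1 = i), bl α D e.1 := by
  classical
  rw [Finset.card_eq_sum_card_fiberwise (f := bE α D)
    (t := ((Finset.univ : Finset D).filter (fun e => u e.1 = i)).map ⟨Subtype.val, Subtype.val_injective⟩),
    Finset.sum_map]
  · apply Finset.sum_congr rfl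
    rintro ⟨e, he⟩ hi
    simp only [Finset.mem_filter, Finset.mem_univ, true_and] at hi
    rw [← Finset.card_range (bl α D e)]
    symm
    apply Finset.card_bij (fun j _ => (α ^ j)⁻¹ e)
    · intro j hj
      simp only [Finset.mem_range] at hj
      simp only [Finset.mem_filter, Finset.mem_univ, true_and, Function.Embedding.coeFn_mk]
      refine ⟨?_, bE_inv α D he hj⟩
      rw [← hu _ (InO_inv α D he j), bE_inv α D he hj, hi]
    · intro j hj j' hj' h
      simp only [Finset.mem_range] at hj hj'
      have := congrArg (bk α D) h
      rwa [bk_inv α D he hj, bk_inv α D he hj'] at this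
    · intro x hx
      simp only [Finset.mem_filter, Finset.mem_univ, true_and, Function.Embedding.coeFn_mk] at hx
      refine ⟨bk α D x, ?_, ?_⟩
      · rw [Finset.mem_range, ← hx.2]
        exact bk_lt α D (hO x hx.1)
      · rw [← hx.2]; exact eq_inv_bE α D x
  · intro x hx
    simp at hx
    simp
    exact ⟨by rw [hu x (hO x hx), hx], bE_mem α D (hO x hx)⟩

end Blocks

lemma exists_inverter {X : Type*} (π : Perm X) (x0 : X) :
    ∃ g : X → X, (∀ y, g (g y) = y) ∧ (∀ y, g (π y) = π⁻¹ (g y)) ∧ g x0 = x0 ∧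
      ∀ y, ∃ j : ℤ, g y = (π ^ j) y := by
  classical
  obtain ⟨r, hr1, hr2, hr3⟩ : ∃ r : X → X, (∀ y z, π.SameCycle y z → r y = r z) ∧
      (∀ y, π.SameCycle (r y) y) ∧ r x0 = x0 := by
    let S := Perm.SameCycle.setoid π
    refine ⟨fun y => if π.SameCycle x0 y then x0 else (Quotient.mk S y).out, ?_, ?_, ?_⟩
    · intro y z h
      have h' : (Quotient.mk S y) = Quotient.mk S z := Quotient.sound h
      have : π.SameCycle x0 y ↔ π.SameCycle x0 z := ⟨fun a => a.trans h, fun a => a.trans h.symm⟩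
      simp only [this, h']
    · intro y
      dsimp only
      split_ifs with h
      · exact h
      · exact Quotient.exact (Quotient.out_eq (Quotient.mk S y))
    · exact if_pos (Perm.SameCycle.refl _ _)
  choose k hk using hr2
  have help : ∀ (a b : ℤ) (r : X), (π ^ a) r = (π ^ b) r → (π ^ (-a)) r = (π ^ (-b)) r := by
    intro a b r h
    have := congrArg (π ^ (-a - b)) h
    rw [← Perm.mul_apply, ← Perm.mul_apply, ← zpow_add, ← zpow_add] at this
    rw [show -a - b + a = -b by ring, show -a - b + b = -a by ring] at this
    exact this.symm
  have hrg : ∀ (y : X) (j : ℤ), r ((π ^ j) (r y)) = r y := by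
    intro y j
    apply hr1
    exact (Perm.SameCycle.symm (f := π) ⟨j, rfl⟩).trans ⟨k y, hk y⟩
  refine ⟨fun y => (π ^ (-k y)) (r y), ?_, ?_, ?_, ?_⟩
  · intro y
    dsimp only
    have h1 := hrg y (-k y)
    have h2 := hk ((π ^ (-k y)) (r y))
    rw [h1] at h2 ⊢
    rw [help _ _ _ h2, neg_neg, hk]
  · intro y
    dsimp only
    have h1 : r (π y) = r y := hr1 _ _ (Perm.SameCycle.symm ⟨1, by simp⟩)
    have h2 := hk (π y)
    rw [h1] at h2 ⊢
    have h3 : (π ^ (k (π y))) (r y) = (π ^ (1 + k y)) (r y) := by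
      rw [h2, zpow_add, Perm.mul_apply, hk]; simp
    rw [help _ _ _ h3, neg_add, zpow_add, Perm.mul_apply]; simp
  · dsimp only
    have h2 := hk x0
    rw [hr3] at h2 ⊢
    have := help (k x0) 0 x0 (by simpa using h2)
    simpa using this
  · intro y
    refine ⟨-k y - k y, ?_⟩
    dsimp only
    conv_rhs => rw [← hk y]
    rw [hr1 _ y ⟨0, by simp⟩, ← Perm.mul_apply, ← zpow_add]
    have e1 : k ((π ^ k y) (r y)) = k y := by rw [hk]
    simp [e1]

lemma perm_ai {X : Type*} (σ : Perm X) (x : X) : σ (σ⁻¹ x) = x := by simp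

lemma perm_ia {X : Type*} (σ : Perm X) (x : X) : σ⁻¹ (σ x) = x := by simp

/-- The labelled situation extracted from the theorem. -/
structure Setup {X : Type*} (α α' β : Perm X) (s : X → Fin 3) (D : Set X) : Prop where
  hβ : ∀ x, β (α' x) = α (β x)
  hD : ∀ x, x ∈ D ↔ α x ≠ α' x
  inv : ∀ x, s (α x) = s x
  two : ∀ x, s x = 2 ↔ α x = x
  cyc : ∀ x y, s x = s y → s x ≠ 2 → ∃ m : ℕ, (α ^ m) x = y
  exS : ∀ i, i ≠ 2 → ∃ d ∈ D, s d = i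
  exT : ∀ i, i ≠ 2 → ∃ d ∈ D, s (β d) = i
  card : D.ncard ≤ 4

namespace Setup

variable {X : Type*} {α α' β : Perm X} {s : X → Fin 3} {D : Set X}

lemma off (h : Setup α α' β s D) {x : X} (hx : x ∉ D) : α' x = α x := by
  by_contra hne
  exact hx ((h.hD x).2 (Ne.symm hne))

lemma inv' (h : Setup α α' β s D) (x : X) : s (β (α' x)) = s (β x) := by rw [h.hβ, h.inv]

lemma two' (h : Setup α α' β s D) (x : X) : s (β x) = 2 ↔ α' x = x := by
  rw [h.two, ← h.hβ]; exact β.injective.eq_iff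

lemma s_pow (h : Setup α α' β s D) (j : ℕ) (x : X) : s ((α ^ j) x) = s x := by
  induction j with
  | zero => simp
  | succ j ih => rw [pow_succ', Perm.mul_apply, h.inv, ih]

lemma s_pow_inv (h : Setup α α' β s D) (j : ℕ) (x : X) : s ((α ^ j)⁻¹ x) = s x := by
  rw [← h.s_pow j]; simp

lemma sE (h : Setup α α' β s D) (x : X) : s (bE α D x) = s x := h.s_pow _ _

lemma tE (h : Setup α α' β s D) (x : X) : s (β (bE α D x)) = s (β x) := by
  have : ∀ j, j ≤ bk α D x → s (β ((α ^ j) x)) = s (β x) := by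
    intro j
    induction j with
    | zero => simp
    | succ j ih =>
      intro hj
      have hn : (α ^ j) x ∉ D := fun hm => Nat.notMem_of_lt_sInf (show j < bk α D x by omega) hm
      rw [pow_succ', Perm.mul_apply, ← h.off hn, h.inv', ih (by omega)]
  exact this _ le_rfl

lemma inO_s (h : Setup α α' β s D) {x : X} (hx : s x ≠ 2) : InO α D x := by
  obtain ⟨d, hd, hs⟩ := h.exS (s x) hx
  obtain ⟨m, hm⟩ := h.cyc x d hs.symm hx
  exact ⟨m, by rw [hm]; exact hd⟩

lemma inO_t (h : Setup α α' β s D) {x : X} (hx : s (β x) ≠ 2) : InO α D x := by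
  by_cases h2 : s x = 2
  · apply InO_of_mem
    rw [h.hD, (h.two x).1 h2]
    intro h3
    exact hx ((h.two' x).2 h3.symm)
  · exact h.inO_s h2

lemma st (h : Setup α α' β s D) {e : X} (he : e ∈ D) (h2 : s e = 2) : s (β e) ≠ 2 := by
  rw [Ne, h.two']
  rw [h.hD, (h.two e).1 h2] at he
  exact Ne.symm he

variable [Fintype X]

lemma p_mem (_ : Setup α α' β s D) {e : X} (he : e ∈ D) : bp α D e ∈ D := (bl_spec α D he).2

lemma q_mem (h : Setup α α' β s D) {e : X} (he : e ∈ D) : α'⁻¹ (α (bp α D e)) ∈ D := by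
  by_contra hn
  have h1 := h.off hn
  rw [perm_ai] at h1
  have h2 := α.injective h1
  exact hn (h2 ▸ h.p_mem he)

lemma q_ne (h : Setup α α' β s D) {e : X} (he : e ∈ D) :
    α'⁻¹ (α (bp α D e)) ≠ bp α D e := by
  rw [Ne, Perm.inv_eq_iff_eq]
  exact (h.hD _).1 (h.p_mem he)

lemma ls (h : Setup α α' β s D) {e : X} (he : e ∈ D) (h2 : s e = 2) : bl α D e = 1 := by
  apply le_antisymm _ (bl_spec α D he).1
  apply bl_le _ _ le_rfl
  rw [pow_one, Perm.inv_eq_iff_eq.2 ((h.two e).1 h2).symm]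
  exact he

lemma lt (h : Setup α α' β s D) {e : X} (he : e ∈ D) (h2 : s (β e) = 2) : bl α D e = 1 := by
  apply le_antisymm _ (bl_spec α D he).1
  apply bl_le _ _ le_rfl
  rw [pow_one]
  by_contra hn
  have h1 := h.off hn
  rw [perm_ai] at h1
  have h3 := α'.injective (h1.trans ((h.two' e).1 h2).symm)
  exact hn (h3.symm ▸ he)

lemma step (_ : Setup α α' β s D) {z : X} (hz : InO α D z) :
    (bE α D (α⁻¹ z) = bE α D z ∧ α⁻¹ z ∉ D) ∨ z = α (bp α D (bE α D z)) := by
  have he := bE_mem α D hz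
  have hk := bk_lt α D hz
  have hz' : α⁻¹ z = (α ^ (bk α D z + 1))⁻¹ (bE α D z) := by
    rw [pow_succ, mul_inv_rev, Perm.mul_apply, eq_inv_bE]
  rcases Nat.lt_or_ge (bk α D z + 1) (bl α D (bE α D z)) with hlt | hge
  · left
    rw [hz']
    exact ⟨bE_inv α D he hlt, bl_min α D (by omega) hlt⟩
  · right
    have : bk α D z + 1 = bl α D (bE α D z) := by omega
    unfold bp
    rw [← this, ← hz']; simp

lemma trans_p (h : Setup α α' β s D) (p : D → D) (hp : ∀ e : D, (p e : X) = bp α D e)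
    (x y : D) (hs : s x = s y) (h2 : s x ≠ 2) : ∃ j, p^[j] x = y := by
  have main : ∀ m : ℕ, ∃ j, (p^[j] x : X) = bE α D ((α ^ m)⁻¹ x) := by
    intro m
    induction m with
    | zero => exact ⟨0, by simp [bE_self α D x.2]⟩
    | succ m ih =>
      obtain ⟨j, hj⟩ := ih
      rw [pow_succ, mul_inv_rev, Perm.mul_apply]
      rcases h.step (InO_inv α D x.2 m) with h1 | h1
      · exact ⟨j, by rw [h1.1, hj]⟩
      · refine ⟨j + 1, ?_⟩
        rw [Function.iterate_succ_apply', hp, hj]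
        conv_rhs => rw [h1]
        rw [perm_ia, ← hj, bE_self α D (h.p_mem (p^[j] x).2)]
  obtain ⟨m, hm⟩ := h.cyc y x hs.symm (hs ▸ h2)
  obtain ⟨j, hj⟩ := main m
  refine ⟨j, Subtype.ext ?_⟩
  rw [hj, ← hm, perm_ia, bE_self α D y.2]

lemma trans_q (h : Setup α α' β s D) (q : D → D)
    (hq : ∀ e : D, (q e : X) = α'⁻¹ (α (bp α D e)))
    (x y : D) (hs : s (β x) = s (β y)) (h2 : s (β x) ≠ 2) : ∃ j, q^[j] x = y := by
  have hpow : ∀ (m : ℕ) (z : X), β ((α' ^ m) z) = (α ^ m) (β z) := by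
    intro m
    induction m with
    | zero => simp
    | succ m ih => intro z; rw [pow_succ', Perm.mul_apply, h.hβ, ih, pow_succ', Perm.mul_apply]
  have hlab : ∀ m : ℕ, s (β ((α' ^ m)⁻¹ x)) = s (β x) := by
    intro m
    rw [← h.s_pow m, ← hpow]; simp
  have main : ∀ m : ℕ, ∃ j, (q^[j] x : X) = bE α D ((α' ^ m)⁻¹ x) := by
    intro m
    induction m with
    | zero => exact ⟨0, by simp [bE_self α D x.2]⟩
    | succ m ih =>
      obtain ⟨j, hj⟩ := ih
      rw [pow_succ, mul_inv_rev, Perm.mul_apply]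
      have hin : InO α D ((α' ^ m)⁻¹ x) := h.inO_t (by rw [hlab]; exact h2)
      rcases h.step hin with h1 | h1
      · have h3 := h.off h1.2
        rw [perm_ai] at h3
        rw [← Perm.eq_inv_iff_eq] at h3
        exact ⟨j, by rw [← h3, h1.1, hj]⟩
      · refine ⟨j + 1, ?_⟩
        rw [Function.iterate_succ_apply', hq, hj]
        conv_rhs => rw [h1]
        rw [← hj, bE_self α D (h.q_mem (q^[j] x).2)]
  obtain ⟨m, hm⟩ := h.cyc (β y) (β x) hs.symm (hs ▸ h2)
  obtain ⟨j, hj⟩ := main m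
  refine ⟨j, Subtype.ext ?_⟩
  rw [← hpow] at hm
  rw [hj, ← β.injective hm, perm_ia, bE_self α D y.2]

lemma getRho (h : Setup α α' β s D) : ∃ r : X → X,
    (∀ e ∈ D, r e ∈ D) ∧ (∀ e ∈ D, r (r e) = e) ∧
    (∀ e ∈ D, bp α D (r (α'⁻¹ (α (bp α D e)))) = r e) ∧ (∀ e ∈ D, s (r e) = s (β e)) ∧
    (∀ e ∈ D, bl α D (r e) = bl α D e) ∧
    (∀ e ∈ D, ∀ e' ∈ D, s e = 2 → s e' = 2 → e = e') := by
  classical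
  have hcs := fun i (hi : i ≠ 2) => card_blocks α D s i (fun x hx => h.inO_s (hx ▸ hi))
    (fun x _ => h.sE x)
  have hct := fun i (hi : i ≠ 2) => card_blocks α D (fun x => s (β x)) i
    (fun x hx => h.inO_t (hx ▸ hi)) (fun x _ => h.tE x)
  let p : D → D := fun e => ⟨bp α D e, h.p_mem e.2⟩
  let q : D → D := fun e => ⟨α'⁻¹ (α (bp α D e)), h.q_mem e.2⟩
  have hpinj : Function.Injective p := by
    intro e e' hee
    exact Subtype.ext (bp_inj α D e.2 e'.2 (congrArg Subtype.val hee))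
  have hqinj : Function.Injective q := by
    intro e e' hee
    have := congrArg Subtype.val hee
    simp only [q] at this
    exact Subtype.ext (bp_inj α D e.2 e'.2 (α.injective (α'⁻¹.injective this)))
  obtain ⟨r, h1, h2, h3, h4, h5⟩ := finMain (D := D)
    (by
      have := h.card
      rwa [← Nat.card_coe_set_eq, Nat.card_eq_fintype_card] at this)
    p q (fun e => s e) (fun e => s (β e)) (fun e => bl α D e) hpinj hqinj
    (fun e => h.s_pow_inv _ _)
    (fun e => by
      have a := h.inv' (α'⁻¹ (α (bp α D e)))
      rw [perm_ai] at a
      change s (β (α'⁻¹ (α (bp α D e)))) = _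
      rw [← a]
      have hin : InO α D (α (bp α D e)) :=
        ⟨bl α D e - 1, by
          unfold bp
          rw [← Perm.mul_apply, ← pow_succ, Nat.sub_add_cancel (bl_spec α D e.2).1]
          simp⟩
      have hE : bE α D (α (bp α D e)) = e := by
        have : α (bp α D e) = (α ^ (bl α D e - 1))⁻¹ e := by
          rw [Perm.eq_inv_iff_eq]
          unfold bp
          rw [← Perm.mul_apply, ← pow_succ, Nat.sub_add_cancel (bl_spec α D e.2).1]
          simp
        rw [this]
        exact bE_inv α D e.2 (by have := (bl_spec α D e.2).1; omega)
      rw [← h.tE, hE])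
    (fun e hh => h.q_ne e.2 (congrArg Subtype.val hh))
    (fun e => h.st e.2)
    (fun e he => by
      apply Subtype.ext
      change bp α D e = e
      unfold bp
      rw [h.ls e.2 he, pow_one, Perm.inv_eq_iff_eq]
      exact ((h.two _).1 he).symm)
    (fun e he => by
      apply Subtype.ext
      change α'⁻¹ (α (bp α D e)) = e
      unfold bp
      rw [h.lt e.2 he, pow_one, Perm.inv_eq_iff_eq, perm_ai]
      exact ((h.two' _).1 he).symm)
    (fun e => h.ls e.2) (fun e => h.lt e.2) (fun e => (bl_spec α D e.2).1)
    (fun x y => h.trans_p p (fun _ => rfl) x y) (fun x y => h.trans_q q (fun _ => rfl) x y)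
    (fun i hi => by obtain ⟨d, hd, hs⟩ := h.exS i hi; exact ⟨⟨d, hd⟩, hs⟩)
    (fun i hi => by obtain ⟨d, hd, hs⟩ := h.exT i hi; exact ⟨⟨d, hd⟩, hs⟩)
    (fun i hi => by
      rw [← hcs i hi, ← hct i hi]
      symm
      exact Finset.card_equiv β (by simp))
    (fun i hi => by
      rw [← hcs i hi]
      obtain ⟨d, _, hs⟩ := h.exS i hi
      have : 1 < (Finset.univ.filter fun x => s x = i).card := by
        rw [Finset.one_lt_card]
        refine ⟨d, by simpa using hs, α d, by simpa [h.inv] using hs, ?_⟩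
        intro hd
        exact hi (hs ▸ (h.two d).2 hd.symm)
      exact this)
  have hr : ∀ (e : X) (he : e ∈ D),
      (fun x => if hx : x ∈ D then (r ⟨x, hx⟩ : X) else x) e = r ⟨e, he⟩ := by
    intro e he; simp [he]
  refine ⟨fun x => if hx : x ∈ D then (r ⟨x, hx⟩ : X) else x, ?_, ?_, ?_, ?_, ?_, ?_⟩
  · intro e he; rw [hr e he]; exact (r _).2
  · intro e he; rw [hr e he, hr _ (r ⟨e, he⟩).2]; simp [h1]
  · intro e he
    rw [hr e he, hr _ (h.q_mem he)]
    exact congrArg Subtype.val (h2 ⟨e, he⟩)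
  · intro e he; rw [hr e he]; exact h3 ⟨e, he⟩
  · intro e he; rw [hr e he]; exact h4 ⟨e, he⟩
  · intro e he e' he' hs hs'
    exact congrArg Subtype.val (h5 ⟨e, he⟩ ⟨e', he'⟩ hs hs')

lemma exists_gamma (h : Setup α α' β s D) : ∃ γ : Perm X, (∀ x, γ (γ x) = x) ∧
    (∀ x, α (γ (α x)) = γ x) ∧ (∀ x, s (γ x) = s x) ∧ (∀ x, γ (β (γ (β x))) = x) := by
  classical
  obtain ⟨r, rD, rr, rpq, rs, rl, runiq⟩ := h.getRho
  have t_off : ∀ x, s x = 2 → x ∉ D → s (β x) = 2 := by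
    intro x hx hn
    rw [h.two', h.off hn]; exact (h.two x).1 hx
  have inO_two : ∀ x, s x = 2 → InO α D x → x ∈ D := by
    rintro x hx ⟨j, hj⟩
    have : (α ^ j) x = x := Perm.pow_apply_eq_self_of_apply_eq_self ((h.two x).1 hx) j
    rwa [this] at hj
  have rt : ∀ e ∈ D, s (β (r e)) = s e := by
    intro e he
    rw [← rs _ (rD e he), rr e he]
  -- the induced permutation of the fixed points
  let f : X → X := fun x => if s x = 2 then (if x ∈ D then β (r x) else β x) else x
  have f1 : ∀ x, s x = 2 → x ∈ D → f x = β (r x) := by intro x h1 h2; simp [f, h1, h2]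
  have f2 : ∀ x, s x = 2 → x ∉ D → f x = β x := by intro x h1 h2; simp [f, h1, h2]
  have f3 : ∀ x, s x ≠ 2 → f x = x := by intro x h1; simp [f, h1]
  have fs : ∀ x, s (f x) = 2 ↔ s x = 2 := by
    intro x
    by_cases h1 : s x = 2
    · by_cases h2 : x ∈ D
      · rw [f1 x h1 h2, rt x h2]
      · rw [f2 x h1 h2]; simp [h1, t_off x h1 h2]
    · rw [f3 x h1]
  have rne : ∀ e ∈ D, s e = 2 → s (r e) ≠ 2 := by
    intro e he h2; rw [rs e he]; exact h.st he h2
  have finj : Function.Injective f := by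
    intro x y hxy
    have hs2 : s x = 2 ↔ s y = 2 := by rw [← fs x, ← fs y, hxy]
    by_cases h1 : s x = 2
    · have h1' := hs2.1 h1
      by_cases h2 : x ∈ D <;> by_cases h2' : y ∈ D
      · exact runiq x h2 y h2' h1 h1'
      · rw [f1 x h1 h2, f2 y h1' h2'] at hxy
        exact absurd (β.injective hxy ▸ h1') (rne x h2 h1)
      · rw [f2 x h1 h2, f1 y h1' h2'] at hxy
        exact absurd ((β.injective hxy).symm ▸ h1) (rne y h2' h1')
      · rw [f2 x h1 h2, f2 y h1' h2'] at hxy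
        exact β.injective hxy
    · rw [f3 x h1, f3 y (fun h' => h1 (hs2.2 h'))] at hxy
      exact hxy
  let π : Perm X := Equiv.ofBijective f (Finite.injective_iff_bijective.1 finj)
  have hπ : ∀ x, π x = f x := fun x => rfl
  obtain ⟨g, gg, gπ, gD, gorb⟩ : ∃ g : X → X, (∀ y, g (g y) = y) ∧
      (∀ y, g (π y) = π⁻¹ (g y)) ∧ (∀ e ∈ D, s e = 2 → g e = e) ∧
      ∀ y, ∃ j : ℤ, g y = (π ^ j) y := by
    by_cases hex : ∃ e ∈ D, s e = 2
    · obtain ⟨e, he, hs⟩ := hex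
      obtain ⟨g, a, b, c, d⟩ := exists_inverter π e
      refine ⟨g, a, b, ?_, d⟩
      intro e' he' hs'
      rw [runiq e' he' e he hs' hs, c]
    · obtain ⟨e, he, hs⟩ := h.exS 0 (by decide)
      obtain ⟨g, a, b, c, d⟩ := exists_inverter π e
      exact ⟨g, a, b, fun e' he' hs' => absurd ⟨e', he', hs'⟩ hex, d⟩
  have gs : ∀ y, s y = 2 → s (g y) = 2 := by
    intro y hy
    by_contra hne
    obtain ⟨j, hj⟩ := gorb y
    have hfix : π (g y) = g y := by rw [hπ, f3 _ hne]
    have h1 : (π ^ (-j)) (g y) = g y := Perm.zpow_apply_eq_self_of_apply_eq_self hfix (-j)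
    have h2 : (π ^ (-j)) (g y) = y := by rw [hj, zpow_neg, perm_ia]
    rw [← h1, h2] at hne
    exact hne hy
  have notO : ∀ x, ¬ InO α D x → s x = 2 ∧ s (β x) = 2 ∧ x ∉ D := by
    intro x hx
    refine ⟨?_, ?_, fun hD => hx (InO_of_mem α D hD)⟩
    · by_contra hn; exact hx (h.inO_s hn)
    · by_contra hn; exact hx (h.inO_t hn)
  have gnotO : ∀ x, ¬ InO α D x → ¬ InO α D (g x) := by
    intro x hx hg
    obtain ⟨h1, h2, h3⟩ := notO x hx
    have h4 := inO_two _ (gs x h1) hg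
    have h5 := gD _ h4 (gs x h1)
    rw [gg] at h5
    exact h3 (h5 ▸ h4)
  -- the block reversal
  let τ : X → X := fun x => if InO α D x then
    (α ^ (bl α D (bE α D x) - 1 - bk α D x))⁻¹ (r (bE α D x)) else g x
  have τ1 : ∀ e ∈ D, ∀ j, j < bl α D e →
      τ ((α ^ j)⁻¹ e) = (α ^ (bl α D e - 1 - j))⁻¹ (r e) := by
    intro e he j hj
    simp only [τ]
    rw [if_pos (InO_inv α D he j), bE_inv α D he hj, bk_inv α D he hj]
  have τ2 : ∀ x, ¬ InO α D x → τ x = g x := by intro x hx; simp only [τ]; rw [if_neg hx]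
  have form : ∀ x, InO α D x → ∃ e ∈ D, ∃ j, j < bl α D e ∧ x = (α ^ j)⁻¹ e := by
    intro x hx
    exact ⟨_, bE_mem α D hx, _, bk_lt α D hx, (eq_inv_bE α D x).symm⟩
  have ττ : ∀ x, τ (τ x) = x := by
    intro x
    by_cases hx : InO α D x
    · obtain ⟨e, he, j, hj, rfl⟩ := form x hx
      rw [τ1 e he j hj, τ1 _ (rD e he) _ (by rw [rl e he]; omega), rr e he, rl e he,
        show bl α D e - 1 - (bl α D e - 1 - j) = j by omega]
    · rw [τ2 x hx, τ2 _ (gnotO x hx), gg]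
  have τs : ∀ x, s (τ x) = s (β x) := by
    intro x
    by_cases hx : InO α D x
    · rw [← h.tE x]
      obtain ⟨e, he, j, hj, rfl⟩ := form x hx
      rw [τ1 e he j hj, h.s_pow_inv, rs e he, bE_inv α D he hj]
    · obtain ⟨h1, h2, h3⟩ := notO x hx
      rw [τ2 x hx, h2, gs x h1]
  have τα : ∀ x, α (τ (α' x)) = τ x := by
    intro x
    by_cases hx : InO α D x
    · obtain ⟨e, he, j, hj, rfl⟩ := form x hx
      rcases Nat.eq_zero_or_pos j with rfl | hpos
      · -- `x = e` is the end of a block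
        have hsurj : ∃ e' ∈ D, α'⁻¹ (α (bp α D e')) = e := by
          let q : D → D := fun e => ⟨α'⁻¹ (α (bp α D e)), h.q_mem e.2⟩
          have hqinj : Function.Injective q := by
            intro e e' hee
            have := congrArg Subtype.val hee
            simp only [q] at this
            exact Subtype.ext (bp_inj α D e.2 e'.2 (α.injective (α'⁻¹.injective this)))
          obtain ⟨e', he'⟩ := (Finite.injective_iff_surjective.1 hqinj) ⟨e, he⟩
          exact ⟨e', e'.2, congrArg Subtype.val he'⟩
        obtain ⟨e', he', hq⟩ := hsurj
        have hr := rpq e' he'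
        rw [hq] at hr
        have hl' := (bl_spec α D he').1
        have hst : α' e = (α ^ (bl α D e' - 1))⁻¹ e' := by
          rw [← hq, perm_ai, Perm.eq_inv_iff_eq]
          unfold bp
          rw [← Perm.mul_apply, ← pow_succ, Nat.sub_add_cancel hl', perm_ai]
        have e0 : (α ^ 0)⁻¹ e = e := by simp
        have h1 := τ1 e he 0 hj
        rw [e0] at h1 ⊢
        rw [hst, τ1 e' he' _ (by omega), h1, Nat.sub_self, Nat.sub_zero]
        simp only [pow_zero, inv_one, Perm.one_apply]
        rw [← hr, Perm.eq_inv_iff_eq]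
        unfold bp
        rw [rl e he, ← Perm.mul_apply, ← pow_succ, Nat.sub_add_cancel (by omega), perm_ai]
      · have hn : (α ^ j)⁻¹ e ∉ D := bl_min α D hpos hj
        have h1 : α ((α ^ j)⁻¹ e) = (α ^ (j - 1))⁻¹ e := by
          have := pow_inv_shift α 1 j hpos e
          rwa [pow_one] at this
        rw [h.off hn, h1, τ1 e he _ (by omega), τ1 e he j hj]
        have := pow_inv_shift α 1 (bl α D e - 1 - (j - 1)) (by omega) (r e)
        rw [pow_one] at this
        rw [this, show bl α D e - 1 - (j - 1) - 1 = bl α D e - 1 - j by omega]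
    · obtain ⟨h1, h2, h3⟩ := notO x hx
      rw [(h.two' x).1 h2, τ2 x hx]
      exact (h.two _).1 (gs x h1)
  let T : Perm X := ⟨τ, τ, ττ, ττ⟩
  have hT : ∀ x, T x = τ x := fun _ => rfl
  refine ⟨T * β⁻¹, ?_, ?_, ?_, ?_⟩
  · -- involution
    have hα : ∀ x, α ((T * β⁻¹) (α x)) = (T * β⁻¹) x := by
      intro x
      have : β⁻¹ (α x) = α' (β⁻¹ x) := by
        rw [Perm.inv_eq_iff_eq, h.hβ, perm_ai]
      rw [Perm.mul_apply, Perm.mul_apply, this, hT, hT, τα]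
    have hs : ∀ x, s ((T * β⁻¹) x) = s x := by
      intro x
      rw [Perm.mul_apply, hT, τs, perm_ai]
    intro x
    by_cases hx : s x = 2
    · have hγ : ∀ w, s w = 2 → (T * β⁻¹) (π w) = g w := by
        intro w hw
        rw [Perm.mul_apply, hT, hπ]
        by_cases hwD : w ∈ D
        · rw [f1 w hw hwD, perm_ia, gD w hwD hw]
          have hl := h.ls hwD hw
          have := τ1 (r w) (rD w hwD) 0 (by rw [rl w hwD, hl]; omega)
          rw [rl w hwD, hl, rr w hwD] at this
          simpa using this
        · rw [f2 w hw hwD, perm_ia]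
          exact τ2 w (fun hO => hwD (inO_two w hw hO))
      obtain ⟨w, rfl⟩ := π.surjective x
      have hw : s w = 2 := by rwa [hπ, fs] at hx
      rw [hγ w hw]
      obtain ⟨v, hv⟩ := π.surjective (g w)
      have hv2 : s v = 2 := by
        have := gs w hw
        rwa [← hv, hπ, fs] at this
      rw [← hv, hγ v hv2]
      have h1 := gπ v
      rw [hv, gg, Perm.eq_inv_iff_eq] at h1
      exact h1.symm
    · obtain ⟨m, hm⟩ := h.cyc x ((T * β⁻¹) x) (hs x).symm hx
      have hpow : ∀ (m : ℕ) (y : X), (α ^ m) ((T * β⁻¹) ((α ^ m) y)) = (T * β⁻¹) y := by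
        intro m
        induction m with
        | zero => simp
        | succ m ih =>
          intro y
          have c1 : (α ^ (m + 1)) y = α ((α ^ m) y) := by rw [pow_succ', Perm.mul_apply]
          have c2 : ∀ z, (α ^ (m + 1)) z = (α ^ m) (α z) := fun z => by
            rw [pow_succ, Perm.mul_apply]
          rw [c2 ((T * β⁻¹) _), c1, hα, ih]
      have := hpow m x
      rw [hm] at this
      have h2 := this.trans hm.symm
      exact (α ^ m).injective h2
  · intro x
    have : β⁻¹ (α x) = α' (β⁻¹ x) := by
      rw [Perm.inv_eq_iff_eq, h.hβ, perm_ai]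
    rw [Perm.mul_apply, Perm.mul_apply, this, hT, hT, τα]
  · intro x
    rw [Perm.mul_apply, hT, τs, perm_ai]
  · intro x
    rw [Perm.mul_apply, Perm.mul_apply, perm_ia, perm_ia, hT, hT, ττ]

end Setup

/-- If `β` has no break on a cycle of `α`, it conjugates a cycle to a cycle. -/
lemma no_break {X : Type*} (α β : Perm X) (s : X → Fin 3) (a : Fin 3 → Perm X)
    (inv : ∀ x, s (α x) = s x) (two : ∀ x, s x = 2 ↔ α x = x)
    (cyc : ∀ x y, s x = s y → s x ≠ 2 → ∃ m : ℕ, (α ^ m) x = y)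
    (ha : ∀ i, i ≠ 2 → ∀ x, a i x = if s x = i then α x else x)
    (i : Fin 3) (hi : i ≠ 2) (hne : ∃ x, s x = i)
    (hb : ∀ x, s x = i → α (β x) = β (α x)) : ∃ j, j ≠ 2 ∧ β⁻¹ * a j * β = a i := by
  obtain ⟨x0, hx0⟩ := hne
  have spow : ∀ (m : ℕ) x, s ((α ^ m) x) = s x := by
    intro m
    induction m with
    | zero => simp
    | succ m ih => intro x; rw [pow_succ', Perm.mul_apply, inv, ih]
  have hpow : ∀ (m : ℕ) x, s x = i → (α ^ m) (β x) = β ((α ^ m) x) := by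
    intro m
    induction m with
    | zero => simp
    | succ m ih =>
      intro x hx
      rw [pow_succ', Perm.mul_apply, ih x hx, hb _ (by rw [spow, hx]), Perm.mul_apply]
  have hj : s (β x0) ≠ 2 := by
    intro h2
    have h3 := (two _).1 h2
    rw [hb x0 hx0] at h3
    exact hi (hx0 ▸ (two x0).2 (β.injective h3))
  have hiff : ∀ x, s (β x) = s (β x0) ↔ s x = i := by
    intro x
    constructor
    · intro hx
      obtain ⟨m, hm⟩ := cyc _ _ hx.symm hj
      rw [hpow m x0 hx0] at hm
      rw [← β.injective hm, spow, hx0]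
    · intro hx
      obtain ⟨m, hm⟩ := cyc x0 x (by rw [hx0, hx]) (hx0 ▸ hi)
      rw [← hm, ← hpow m x0 hx0, spow]
  refine ⟨s (β x0), hj, ?_⟩
  ext x
  rw [Perm.mul_apply, Perm.mul_apply, Perm.inv_eq_iff_eq, ha _ hj, ha _ hi]
  by_cases hx : s x = i
  · rw [if_pos ((hiff x).2 hx), if_pos hx, hb x hx]
  · rw [if_neg (fun h => hx ((hiff x).1 h)), if_neg hx]

/-- Proposition 4.4: α = α₁α₂ a product of two disjoint nontrivial cycles,
[α,β] nontrivial moving at most 4 points, and conjugation by β sends no αᵢ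
into {α₁, α₂}; then some γ simultaneously inverts α₁, α₂ and β. -/
theorem stmt_11 {n : ℕ} (α α₁ α₂ β : Equiv.Perm (Fin n))
    (hα : α = α₁ * α₂) (h₁ : α₁.IsCycle) (h₂ : α₂.IsCycle) (hd : α₁.Disjoint α₂)
    (h1 : 0 < (α⁻¹ * β⁻¹ * α * β).support.card)
    (h2 : (α⁻¹ * β⁻¹ * α * β).support.card ≤ 4)
    (hc1 : β⁻¹ * α₁ * β ∉ ({α₁, α₂} : Set (Equiv.Perm (Fin n))))
    (hc2 : β⁻¹ * α₂ * β ∉ ({α₁, α₂} : Set (Equiv.Perm (Fin n)))) :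
    ∃ γ : Equiv.Perm (Fin n), γ⁻¹ * α₁ * γ = α₁⁻¹ ∧ γ⁻¹ * α₂ * γ = α₂⁻¹ ∧
      γ⁻¹ * β * γ = β⁻¹ := by
  classical
  let s : Fin n → Fin 3 := fun x => if α₁ x ≠ x then 0 else if α₂ x ≠ x then 1 else 2
  have s0 : ∀ x, s x = 0 ↔ α₁ x ≠ x := by
    intro x; simp only [s]; split_ifs <;> simp_all
  have s1 : ∀ x, s x = 1 ↔ α₂ x ≠ x := by
    intro x
    have := hd x
    simp only [s]; split_ifs <;> simp_all
  have s2 : ∀ x, s x = 2 ↔ (α₁ x = x ∧ α₂ x = x) := by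
    intro x; simp only [s]; split_ifs <;> simp_all
  have e0 : ∀ x, s x = 0 → α x = α₁ x := by
    intro x hx
    rw [hα, Perm.mul_apply, (hd x).resolve_left ((s0 x).1 hx)]
  have e1 : ∀ x, s x = 1 → α x = α₂ x := by
    intro x hx
    rw [hα, hd.commute.eq, Perm.mul_apply, (hd x).resolve_right ((s1 x).1 hx)]
  have e2 : ∀ x, s x = 2 → α x = x := by
    intro x hx
    obtain ⟨a, b⟩ := (s2 x).1 hx
    rw [hα, Perm.mul_apply, b, a]
  have tri : ∀ i : Fin 3, i = 0 ∨ i = 1 ∨ i = 2 := by decide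
  have inv : ∀ x, s (α x) = s x := by
    intro x
    rcases tri (s x) with hx | hx | hx
    · rw [e0 x hx, hx, s0]
      intro hh; exact (s0 x).1 hx (α₁.injective hh)
    · rw [e1 x hx, hx, s1]
      intro hh; exact (s1 x).1 hx (α₂.injective hh)
    · rw [e2 x hx]
  have two : ∀ x, s x = 2 ↔ α x = x := by
    intro x
    refine ⟨e2 x, fun hx => ?_⟩
    rcases tri (s x) with hs | hs | hs
    · exact absurd ((e0 x hs).symm.trans hx) ((s0 x).1 hs)
    · exact absurd ((e1 x hs).symm.trans hx) ((s1 x).1 hs)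
    · exact hs
  have spow : ∀ (m : ℕ) x, s ((α ^ m) x) = s x := by
    intro m
    induction m with
    | zero => simp
    | succ m ih => intro x; rw [pow_succ', Perm.mul_apply, inv, ih]
  have p0 : ∀ (m : ℕ) x, s x = 0 → (α ^ m) x = (α₁ ^ m) x := by
    intro m x hx
    induction m with
    | zero => simp
    | succ m ih =>
      rw [pow_succ', Perm.mul_apply, e0 _ (by rw [spow, hx]), ih, pow_succ', Perm.mul_apply]
  have p1 : ∀ (m : ℕ) x, s x = 1 → (α ^ m) x = (α₂ ^ m) x := by
    intro m x hx
    induction m with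
    | zero => simp
    | succ m ih =>
      rw [pow_succ', Perm.mul_apply, e1 _ (by rw [spow, hx]), ih, pow_succ', Perm.mul_apply]
  have cyc : ∀ x y, s x = s y → s x ≠ 2 → ∃ m : ℕ, (α ^ m) x = y := by
    intro x y hxy hx
    rcases tri (s x) with hs | hs | hs
    · obtain ⟨m, hm⟩ := h₁.exists_pow_eq ((s0 x).1 hs) ((s0 y).1 (hxy ▸ hs))
      exact ⟨m, by rw [p0 m x hs, hm]⟩
    · obtain ⟨m, hm⟩ := h₂.exists_pow_eq ((s1 x).1 hs) ((s1 y).1 (hxy ▸ hs))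
      exact ⟨m, by rw [p1 m x hs, hm]⟩
    · exact absurd hs hx
  let a : Fin 3 → Perm (Fin n) := ![α₁, α₂, 1]
  have ha : ∀ i, i ≠ 2 → ∀ x, a i x = if s x = i then α x else x := by
    intro i hi x
    rcases tri i with rfl | rfl | rfl
    · change α₁ x = _
      split_ifs with hx
      · exact (e0 x hx).symm
      · by_contra hh; exact hx ((s0 x).2 hh)
    · change α₂ x = _
      split_ifs with hx
      · exact (e1 x hx).symm
      · by_contra hh; exact hx ((s1 x).2 hh)
    · exact absurd rfl hi
  have hca : ∀ i j, i ≠ 2 → j ≠ 2 → β⁻¹ * a i * β ≠ a j := by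
    intro i j hi hj hij
    have hmem : a j ∈ ({α₁, α₂} : Set (Equiv.Perm (Fin n))) := by
      rcases tri j with rfl | rfl | rfl
      · left; rfl
      · right; rfl
      · exact absurd rfl hj
    rcases tri i with rfl | rfl | rfl
    · exact hc1 (by rw [← hij] at hmem; exact hmem)
    · exact hc2 (by rw [← hij] at hmem; exact hmem)
    · exact absurd rfl hi
  have hne : ∀ i : Fin 3, i ≠ 2 → ∃ x, s x = i := by
    intro i hi
    rcases tri i with rfl | rfl | rfl
    · obtain ⟨x, hx, -⟩ := h₁; exact ⟨x, (s0 x).2 hx⟩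
    · obtain ⟨x, hx, -⟩ := h₂; exact ⟨x, (s1 x).2 hx⟩
    · exact absurd rfl hi
  have hset : Setup α (β⁻¹ * α * β) β s {x | α x ≠ (β⁻¹ * α * β) x} := by
    refine ⟨?_, fun x => Iff.rfl, inv, two, cyc, ?_, ?_, ?_⟩
    · intro x; simp [Perm.mul_apply]
    · intro i hi
      by_contra hcon
      push Not at hcon
      obtain ⟨j, hj, hh⟩ := no_break α β s a inv two cyc ha i hi (hne i hi) (by
        intro x hx
        by_contra hx'
        refine hcon x ?_ hx
        intro hh
        apply hx'
        rw [hh]; simp [Perm.mul_apply])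
      exact hca j i hj hi hh
    · intro i hi
      by_contra hcon
      push Not at hcon
      obtain ⟨j, hj, hh⟩ := no_break α β⁻¹ s a inv two cyc ha i hi (hne i hi) (by
        intro x hx
        by_contra hx'
        refine hcon (β⁻¹ x) ?_ (by rw [perm_ai]; exact hx)
        intro hh
        apply hx'
        rw [hh]; simp [Perm.mul_apply])
      refine hca i j hi hj ?_
      rw [← hh]; group
    · refine le_trans (le_of_eq ?_) h2
      rw [← Set.ncard_coe_finset]
      congr 1
      ext x
      simp only [Set.mem_ofPred_eq, Finset.mem_coe, Perm.mem_support]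
      have c : (α⁻¹ * β⁻¹ * α * β) x = α⁻¹ ((β⁻¹ * α * β) x) := rfl
      rw [c, Ne, Ne, Perm.inv_eq_iff_eq]
      first
        | exact Iff.rfl
        | exact not_congr eq_comm
  obtain ⟨γ, g1, g2, g3, g4⟩ := hset.exists_gamma
  have ginv : γ⁻¹ = γ := by
    ext x
    rw [Perm.inv_eq_iff_eq.2 (g1 x).symm]
  have ga : ∀ i, i ≠ 2 → γ⁻¹ * a i * γ = (a i)⁻¹ := by
    intro i hi
    rw [eq_inv_iff_mul_eq_one, ginv]
    ext x
    congr 1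
    simp only [Perm.mul_apply, Perm.one_apply]
    by_cases hx : s x = i
    · rw [ha i hi x, if_pos hx, ha i hi, if_pos (by rw [g3, inv, hx]), g2, g1]
    · rw [ha i hi x, if_neg hx, ha i hi, if_neg (by rw [g3]; exact hx), g1]
  refine ⟨γ, ga 0 (by decide), ga 1 (by decide), ?_⟩
  rw [eq_inv_iff_mul_eq_one, ginv]
  ext x
  congr 1
  simp only [Perm.mul_apply, Perm.one_apply]
  exact g4 x
end

section
/- Let α = α₁α₂α₃ be a product of three disjoint nontrivial cycles in S_n and β ∈ S_n such that 0 < |M([α,β])| ≤ 4 and β⁻¹α_iβ ∉ {α₁,α₂,α₃} for i = 1,2,3. Then there exists γ ∈ S_n with γ⁻¹α_iγ = α_i⁻¹ for i = 1,2,3 and γ⁻¹βγ = β⁻¹. -/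
namespace ThreeCycles

open Equiv

set_option linter.unusedSectionVars false

variable {V : Type*} [Fintype V] [DecidableEq V]

/-- The supports of three disjoint cycles of `α`, covering all moved points. -/
structure Cfg (α : Perm V) (A B C : Finset V) : Prop where
  dAB : ∀ x ∈ A, x ∉ B
  dAC : ∀ x ∈ A, x ∉ C
  dBC : ∀ x ∈ B, x ∉ C
  sA : ∀ x ∈ A, ∀ y, α.SameCycle x y ↔ y ∈ A
  sB : ∀ x ∈ B, ∀ y, α.SameCycle x y ↔ y ∈ B
  sC : ∀ x ∈ C, ∀ y, α.SameCycle x y ↔ y ∈ C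
  mA : ∀ x ∈ A, α x ≠ x
  mB : ∀ x ∈ B, α x ≠ x
  mC : ∀ x ∈ C, α x ≠ x
  fx : ∀ x, x ∉ A → x ∉ B → x ∉ C → α x = x

/-- The conclusion: a common inverting permutation. -/
def Concl (α β : Perm V) (A B C : Finset V) : Prop :=
  ∃ γ : Perm V, (∀ x, α (γ (α x)) = γ x) ∧ (∀ x, β (γ (β x)) = γ x) ∧
    (∀ x ∈ A, γ x ∈ A) ∧ (∀ x ∈ B, γ x ∈ B) ∧ (∀ x ∈ C, γ x ∈ C)

lemma Cfg.swap {α : Perm V} {A B C : Finset V} (h : Cfg α A B C) : Cfg α B A C :=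
  ⟨fun x hx hx' => h.dAB x hx' hx, h.dBC, h.dAC, h.sB, h.sA, h.sC, h.mB, h.mA, h.mC,
    fun x a b c => h.fx x b a c⟩

lemma Cfg.swap' {α : Perm V} {A B C : Finset V} (h : Cfg α A B C) : Cfg α A C B :=
  ⟨h.dAC, h.dAB, fun x hx hx' => h.dBC x hx' hx, h.sA, h.sC, h.sB, h.mA, h.mC, h.mB,
    fun x a b c => h.fx x a c b⟩

lemma Concl.swap {α β : Perm V} {A B C : Finset V} (h : Concl α β A B C) : Concl α β B A C := by
  obtain ⟨g, h1, h2, h3, h4, h5⟩ := h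
  exact ⟨g, h1, h2, h4, h3, h5⟩

lemma Concl.swap' {α β : Perm V} {A B C : Finset V} (h : Concl α β A B C) : Concl α β A C B := by
  obtain ⟨g, h1, h2, h3, h4, h5⟩ := h
  exact ⟨g, h1, h2, h3, h5, h4⟩

lemma inv_on {f : Perm V} (p : V → Prop) (h : ∀ x, p x → p (f x)) : ∀ x, p (f x) → p x := by
  intro x hx
  have hpow : ∀ k : ℕ, p ((f ^ k) (f x)) := by
    intro k
    induction k with
    | zero => simpa using hx
    | succ k ih => rw [pow_succ', Perm.mul_apply]; exact h _ ih
  have := hpow (orderOf f - 1)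
  rwa [← Perm.mul_apply, ← pow_succ, Nat.sub_add_cancel (orderOf_pos f), pow_orderOf_eq_one,
    Perm.one_apply] at this

lemma path (α : Perm V) {c d : V} (h : α.SameCycle c d) :
    ∃ s : ℕ, 0 < s ∧ (α ^ s) c = d ∧ ∀ j, 0 < j → j < s → (α ^ j) c ≠ c ∧ (α ^ j) c ≠ d := by
  classical
  have hex : ∃ s : ℕ, 0 < s ∧ (α ^ s) c = d := by
    obtain ⟨i, h0, _, hi⟩ := h.exists_pow_eq''
    exact ⟨i, h0, hi⟩
  refine ⟨Nat.find hex, (Nat.find_spec hex).1, (Nat.find_spec hex).2, fun j h0 hj => ⟨?_, ?_⟩⟩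
  · intro hc
    have := Nat.find_min hex (m := Nat.find hex - j) (by omega)
    apply this
    refine ⟨by omega, ?_⟩
    have h2 := (Nat.find_spec hex).2
    have h3 : Nat.find hex = (Nat.find hex - j) + j := by omega
    rw [h3, pow_add, Perm.mul_apply, hc] at h2
    exact h2
  · intro hc
    exact Nat.find_min hex hj ⟨h0, hc⟩

lemma comm_path (α β : Perm V) {c : V} {s : ℕ}
    (h : ∀ j, 0 < j → j < s → β (α ((α ^ j) c)) = α (β ((α ^ j) c))) :
    ∀ j, j < s → β ((α ^ (j + 1)) c) = (α ^ j) (β (α c)) := by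
  intro j
  induction j with
  | zero => simp
  | succ j ih =>
    intro hj
    rw [pow_succ' α (j+1), Perm.mul_apply, h (j+1) (by omega) hj, ih (by omega),
      pow_succ' α j, Perm.mul_apply]

lemma reach (α : Perm V) (P : V → Prop) (a : V) (ha : P a)
    (hstep : ∀ x, α.SameCycle x a → x ≠ a → P (α x) → P x) :
    ∀ x, α.SameCycle x a → P x := by
  have key : ∀ k : ℕ, ∀ x, (α ^ k) x = a → P x := by
    intro k
    induction k with
    | zero => intro x hx; simp at hx; exact hx ▸ ha
    | succ k ih =>
      intro x hx
      by_cases hxa : x = a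
      · exact hxa ▸ ha
      · refine hstep x ⟨((k+1 : ℕ) : ℤ), by rw [zpow_natCast]; exact hx⟩ hxa (ih _ ?_)
        rw [pow_succ, Perm.mul_apply] at hx
        exact hx
  intro x hx
  obtain ⟨i, _, hi⟩ := hx.exists_pow_eq'
  exact key i x hi

lemma refl_wd (α : Perm V) {u v : V} (h : α.SameCycle u v) {k m : ℤ}
    (hkm : (α ^ k) u = (α ^ m) u) : (α ^ (-k)) v = (α ^ (-m)) v := by
  obtain ⟨t, rfl⟩ := h
  have h2 : (α ^ (t - k - m)) ((α ^ k) u) = (α ^ (t - k - m)) ((α ^ m) u) := by rw [hkm]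
  simp only [← Perm.mul_apply, ← zpow_add] at h2 ⊢
  rw [show -k + t = t - k - m + m by ring, show -m + t = t - k - m + k by ring, h2]

lemma mk_gamma {α : Perm V} {A B C : Finset V} (h : Cfg α A B C) {u1 v1 u2 v2 u3 v3 : V}
    (hu1 : u1 ∈ A) (hv1 : v1 ∈ A) (hu2 : u2 ∈ B) (hv2 : v2 ∈ B) (hu3 : u3 ∈ C) (hv3 : v3 ∈ C)
    (δ : Perm V) (hδ : ∀ x, δ x ∉ A ∧ δ x ∉ B ∧ δ x ∉ C ↔ x ∉ A ∧ x ∉ B ∧ x ∉ C) :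
    ∃ γ : Perm V, (∀ k : ℤ, γ ((α ^ k) u1) = (α ^ (-k)) v1) ∧
      (∀ k : ℤ, γ ((α ^ k) u2) = (α ^ (-k)) v2) ∧
      (∀ k : ℤ, γ ((α ^ k) u3) = (α ^ (-k)) v3) ∧
      ∀ x, x ∉ A ∧ x ∉ B ∧ x ∉ C → γ x = δ x := by
  have e1 : ∀ k : ℤ, (α ^ k) u1 ∈ A := fun k => (h.sA u1 hu1 _).1 ⟨k, rfl⟩
  have e2 : ∀ k : ℤ, (α ^ k) u2 ∈ B := fun k => (h.sB u2 hu2 _).1 ⟨k, rfl⟩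
  have e3 : ∀ k : ℤ, (α ^ k) u3 ∈ C := fun k => (h.sC u3 hu3 _).1 ⟨k, rfl⟩
  have hR : ∀ x, ∃ y, (∀ k : ℤ, x = (α ^ k) u1 → y = (α ^ (-k)) v1) ∧
      (∀ k : ℤ, x = (α ^ k) u2 → y = (α ^ (-k)) v2) ∧
      (∀ k : ℤ, x = (α ^ k) u3 → y = (α ^ (-k)) v3) ∧
      (x ∉ A ∧ x ∉ B ∧ x ∉ C → y = δ x) := by
    intro x
    by_cases hA : x ∈ A
    · obtain ⟨k, rfl⟩ := (h.sA u1 hu1 x).2 hA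
      refine ⟨(α ^ (-k)) v1, fun m hm => refl_wd α ((h.sA u1 hu1 _).2 hv1) hm, fun m hm => ?_,
        fun m hm => ?_, fun hx => absurd hA hx.1⟩
      · exact absurd (hm ▸ e2 m) (h.dAB _ hA)
      · exact absurd (hm ▸ e3 m) (h.dAC _ hA)
    by_cases hB : x ∈ B
    · obtain ⟨k, rfl⟩ := (h.sB u2 hu2 x).2 hB
      refine ⟨(α ^ (-k)) v2, fun m hm => ?_, fun m hm => refl_wd α ((h.sB u2 hu2 _).2 hv2) hm,
        fun m hm => ?_, fun hx => absurd hB hx.2.1⟩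
      · exact absurd (hm ▸ e1 m) hA
      · exact absurd (hm ▸ e3 m) (h.dBC _ hB)
    by_cases hC : x ∈ C
    · obtain ⟨k, rfl⟩ := (h.sC u3 hu3 x).2 hC
      refine ⟨(α ^ (-k)) v3, fun m hm => ?_, fun m hm => ?_,
        fun m hm => refl_wd α ((h.sC u3 hu3 _).2 hv3) hm, fun hx => absurd hC hx.2.2⟩
      · exact absurd (hm ▸ e1 m) hA
      · exact absurd (hm ▸ e2 m) hB
    · exact ⟨δ x, fun m hm => absurd (hm ▸ e1 m) hA, fun m hm => absurd (hm ▸ e2 m) hB,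
        fun m hm => absurd (hm ▸ e3 m) hC, fun _ => rfl⟩
  choose g g1 g2 g3 g4 using hR
  have hs : Function.Surjective g := by
    intro y
    by_cases hA : y ∈ A
    · obtain ⟨k, rfl⟩ := (h.sA v1 hv1 y).2 hA
      exact ⟨(α ^ (-k)) u1, by rw [g1 _ (-k) rfl, neg_neg]⟩
    by_cases hB : y ∈ B
    · obtain ⟨k, rfl⟩ := (h.sB v2 hv2 y).2 hB
      exact ⟨(α ^ (-k)) u2, by rw [g2 _ (-k) rfl, neg_neg]⟩
    by_cases hC : y ∈ C
    · obtain ⟨k, rfl⟩ := (h.sC v3 hv3 y).2 hC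
      exact ⟨(α ^ (-k)) u3, by rw [g3 _ (-k) rfl, neg_neg]⟩
    · refine ⟨δ⁻¹ y, ?_⟩
      have e : δ (δ⁻¹ y) = y := by simp
      rw [g4, e]
      rw [← hδ, e]
      exact ⟨hA, hB, hC⟩
  refine ⟨Equiv.ofBijective g ⟨Finite.injective_iff_surjective.2 hs, hs⟩, fun k => ?_, fun k => ?_,
    fun k => ?_, fun x hx => ?_⟩
  · exact g1 _ k rfl
  · exact g2 _ k rfl
  · exact g3 _ k rfl
  · exact g4 _ hx

/-- A permutation preserving a set is inverted there by some permutation preserving the set. -/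
lemma exists_delta (β : Perm V) (p : V → Prop) [DecidablePred p] (hp : ∀ x, p (β x) ↔ p x) :
    ∃ δ : Perm V, (∀ x, p (δ x) ↔ p x) ∧ ∀ x, p x → β (δ (β x)) = δ x := by
  set b : Perm {x // p x} := β.subtypePerm hp with hb
  have hc : IsConj b b⁻¹ := by
    rw [Perm.isConj_iff_cycleType_eq, Perm.cycleType_inv]
  obtain ⟨c, hc⟩ := isConj_iff.1 hc
  refine ⟨Perm.ofSubtype c, fun x => ?_, fun x hx => ?_⟩
  · by_cases hx : p x
    · rw [Perm.ofSubtype_apply_of_mem c hx]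
      exact ⟨fun _ => hx, fun _ => (c ⟨x, hx⟩).2⟩
    · rw [Perm.ofSubtype_apply_of_not_mem c hx]
  · have h1 : b * c * b = c := by
      have : c * b = b⁻¹ * c := by rw [← hc]; group
      rw [mul_assoc, this]; group
    have h2 : b (c (b ⟨x, hx⟩)) = c ⟨x, hx⟩ := by
      conv_rhs => rw [← h1]
      rfl
    have h3 : β x = (b ⟨x, hx⟩ : V) := rfl
    rw [Perm.ofSubtype_apply_of_mem c hx, Perm.ofSubtype_apply_of_mem c ((hp x).2 hx), ← h2]
    rfl


lemma core {α β : Perm V} {A B C : Finset V} (h : Cfg α A B C) {a b c d : V}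
    (ha : a ∈ A) (hb : b ∈ B) (hc : c ∈ C) (hd : d ∈ C)
    (hD : ∀ x, x ≠ a → x ≠ b → x ≠ c → x ≠ d → β (α x) = α (β x))
    (t1 : β (α b) = α (β a)) (t2 : β (α a) = α (β b))
    (t3 : β (α d) = α (β c)) (t4 : β (α c) = α (β d))
    (hpres : ∀ x, (β x ∉ A ∧ β x ∉ B ∧ β x ∉ C) ↔ (x ∉ A ∧ x ∉ B ∧ x ∉ C))
    (hβd : β d ∈ A) (hβc : β c ∈ B) (hβa : β a ∈ C) : Concl α β A B C := by
  -- counting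
  obtain ⟨l, hl0, hl1, hl2⟩ := path α (Perm.SameCycle.refl α a)
  obtain ⟨s, hs0, hs1, hs2⟩ := path α ((h.sC c hc d).2 hd)
  have memA : ∀ j : ℕ, (α ^ j) a ∈ A := fun j => (h.sA a ha _).1 ⟨j, by rw [zpow_natCast]⟩
  have memC : ∀ j : ℕ, (α ^ j) c ∈ C := fun j => (h.sC c hc _).1 ⟨j, by rw [zpow_natCast]⟩
  have cpA := comm_path α β (c := a) (s := l) (fun j h0 hj => hD _ (hl2 j h0 hj).1
    (fun e => h.dAB _ (memA j) (e ▸ hb)) (fun e => h.dAC _ (memA j) (e ▸ hc))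
    (fun e => h.dAC _ (memA j) (e ▸ hd)))
  have cpC := comm_path α β (c := c) (s := s) (fun j h0 hj => hD _
    (fun e => h.dAC a ha (e ▸ memC j)) (fun e => h.dBC b hb (e ▸ memC j))
    (hs2 j h0 hj).1 (hs2 j h0 hj).2)
  have hba : β a = (α ^ l) (β b) := by
    have := cpA (l - 1) (by omega)
    rw [Nat.sub_add_cancel hl0, hl1, t2, ← Perm.mul_apply, ← pow_succ,
      Nat.sub_add_cancel hl0] at this
    exact this
  have hcd : ∀ j, 0 < j → j ≤ s → β ((α ^ j) c) = (α ^ j) (β d) := by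
    intro j h0 hj
    have := cpC (j - 1) (by omega)
    rw [Nat.sub_add_cancel h0, t4, ← Perm.mul_apply (α ^ (j - 1)) α, ← pow_succ,
      Nat.sub_add_cancel h0] at this
    exact this
  obtain ⟨k, hk⟩ := (h.sA a ha _).2 hβd
  have per : ∀ j : ℕ, (α ^ j) (β d) = β d ↔ (α ^ j) a = a := by
    intro j
    rw [← hk, ← Perm.mul_apply, ← zpow_natCast, (Commute.zpow_zpow_self α j k).eq,
      Perm.mul_apply, EmbeddingLike.apply_eq_iff_eq]
  have hsl : s = l := by
    have h1 := hcd s hs0 le_rfl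
    rw [hs1] at h1
    have h2 := (per s).1 h1.symm
    have h3 : ¬ s < l := fun hlt => (hl2 s hs0 hlt).1 h2
    have h4 : ¬ l < s := fun hlt => by
      have h5 := hcd l hl0 hlt.le
      rw [(per l).2 hl1] at h5
      exact (hs2 l hl0 hlt).2 (β.injective h5)
    omega
  subst hsl
  -- construction of γ
  obtain ⟨δ, hδ1, hδ2⟩ := exists_delta β (fun x => x ∉ A ∧ x ∉ B ∧ x ∉ C) hpres
  have hαa : α a ∈ A := by simpa using memA 1
  have hαc : α c ∈ C := by simpa using memC 1
  have hαb : α b ∈ B := (h.sB b hb _).1 ⟨1, by simp⟩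
  obtain ⟨γ, g1, g2, g3, g4⟩ := mk_gamma h hαa hβd hαb hβc hαc hβa δ hδ1
  have cases4 : ∀ x, x ∈ A ∨ x ∈ B ∨ x ∈ C ∨ (x ∉ A ∧ x ∉ B ∧ x ∉ C) := by
    intro x; tauto
  have hγα : ∀ x, α (γ (α x)) = γ x := by
    have key : ∀ (u v : V) (k : ℤ), (∀ k : ℤ, γ ((α ^ k) u) = (α ^ (-k)) v) →
        α (γ (α ((α ^ k) u))) = γ ((α ^ k) u) := by
      intro u v k hk
      rw [hk, ← Perm.mul_apply α (α ^ k), ← zpow_one_add, hk, ← Perm.mul_apply, ← zpow_one_add]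
      congr 2
      ring
    intro x
    rcases cases4 x with hx | hx | hx | hx
    · obtain ⟨k, rfl⟩ := (h.sA _ hαa x).2 hx
      exact key _ _ k g1
    · obtain ⟨k, rfl⟩ := (h.sB _ hαb x).2 hx
      exact key _ _ k g2
    · obtain ⟨k, rfl⟩ := (h.sC _ hαc x).2 hx
      exact key _ _ k g3
    · rw [h.fx x hx.1 hx.2.1 hx.2.2, g4 x hx]
      have := (hδ1 x).2 hx
      exact h.fx _ this.1 this.2.1 this.2.2
  have inv : ∀ u v : V, α.SameCycle u v → (∀ k : ℤ, γ ((α ^ k) u) = (α ^ (-k)) v) →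
      γ u = v ∧ γ v = u := by
    intro u v huv hk
    refine ⟨by simpa using hk 0, ?_⟩
    obtain ⟨t, rfl⟩ := huv
    rw [hk, ← Perm.mul_apply, ← zpow_add]
    simp
  obtain ⟨i1, j1⟩ := inv _ _ ((h.sA _ hαa _).2 hβd) g1
  obtain ⟨i2, j2⟩ := inv _ _ ((h.sB _ hαb _).2 hβc) g2
  obtain ⟨i3, j3⟩ := inv _ _ ((h.sC _ hαc _).2 hβa) g3
  have powγ : ∀ (j : ℕ) x, (α ^ j) (γ ((α ^ j) x)) = γ x := by
    intro j
    induction j with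
    | zero => simp
    | succ j ih =>
      intro x
      have e : (α ^ (j + 1)) x = α ((α ^ j) x) := by rw [pow_succ', Perm.mul_apply]
      rw [e, pow_succ, Perm.mul_apply, hγα, ih]
  have i4 : γ (α d) = β b := by
    apply (α ^ s).injective
    have e : (α ^ s) (α c) = α d := by
      rw [← Perm.mul_apply, ← pow_succ, pow_succ', Perm.mul_apply, hs1]
    rw [← hba, ← e, powγ, i3]
  have j4 : γ (β b) = α d := by
    rw [← powγ s, ← hba, j3, ← Perm.mul_apply, ← pow_succ, pow_succ', Perm.mul_apply, hs1]
  -- β is inverted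
  have Pa : β (γ (β a)) = γ a := by rw [j3, t4, ← i1, hγα]
  have Pb : β (γ (β b)) = γ b := by rw [j4, t3, ← i2, hγα]
  have Pc : β (γ (β c)) = γ c := by rw [j2, t1, ← i3, hγα]
  have Pd : β (γ (β d)) = γ d := by rw [j1, t2, ← i4, hγα]
  have step : ∀ x, x ≠ a → x ≠ b → x ≠ c → x ≠ d →
      β (γ (β (α x))) = γ (α x) → β (γ (β x)) = γ x := by
    intro x xa xb xc xd hP
    have e1 : α (γ (β (α x))) = γ (β x) := by rw [hD x xa xb xc xd, hγα]
    have inj : ∀ z w, γ (β w) = α z → x ≠ w → γ (β (α x)) ≠ z := by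
      intro z w hw hxw hz
      rw [hz, ← hw] at e1
      exact hxw (β.injective (γ.injective e1.symm))
    rw [← e1, hD _ (inj a d j1 xd) (inj b c j2 xc) (inj c a j3 xa) (inj d b j4 xb), hP, hγα]
  refine ⟨γ, hγα, fun x => ?_, fun x hx => ?_, fun x hx => ?_, fun x hx => ?_⟩
  · rcases cases4 x with hx | hx | hx | hx
    · refine reach α (fun x => β (γ (β x)) = γ x) a Pa (fun x hxa hne hP => ?_) x
        ((h.sA x hx a).2 ha)
      have hx := (h.sA a ha x).1 hxa.symm
      exact step x hne (fun e => h.dAB _ hx (e ▸ hb)) (fun e => h.dAC _ hx (e ▸ hc))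
        (fun e => h.dAC _ hx (e ▸ hd)) hP
    · refine reach α (fun x => β (γ (β x)) = γ x) b Pb (fun x hxa hne hP => ?_) x
        ((h.sB x hx b).2 hb)
      have hx := (h.sB b hb x).1 hxa.symm
      exact step x (fun e => h.dAB a ha (e ▸ hx)) hne (fun e => h.dBC _ hx (e ▸ hc))
        (fun e => h.dBC _ hx (e ▸ hd)) hP
    · refine reach α (fun x => β (γ (β x)) = γ x) c Pc (fun x hxa hne hP => ?_) x
        ((h.sC x hx c).2 hc)
      have hx := (h.sC c hc x).1 hxa.symm
      by_cases hxd : x = d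
      · exact hxd ▸ Pd
      exact step x (fun e => h.dAC a ha (e ▸ hx)) (fun e => h.dBC b hb (e ▸ hx)) hne hxd hP
    · rw [g4 _ ((hpres x).2 hx), g4 x hx]
      exact hδ2 x hx
  · obtain ⟨k, rfl⟩ := (h.sA _ hαa x).2 hx
    rw [g1]; exact (h.sA _ hβd _).1 ⟨_, rfl⟩
  · obtain ⟨k, rfl⟩ := (h.sB _ hαb x).2 hx
    rw [g2]; exact (h.sB _ hβc _).1 ⟨_, rfl⟩
  · obtain ⟨k, rfl⟩ := (h.sC _ hαc x).2 hx
    rw [g3]; exact (h.sC _ hβa _).1 ⟨_, rfl⟩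

lemma E_of {α β : Perm V} {x y : V} (h : β (α y) = α (β x)) : α.SameCycle (β x) (β (α y)) := by
  rw [h]; exact ⟨1, by simp⟩

lemma E_single {α β : Perm V} {a : V}
    (h : ∀ x, α.SameCycle x a → x ≠ a → β (α x) = α (β x)) :
    ∀ x, α.SameCycle x a → α.SameCycle (β x) (β a) :=
  reach α (fun x => α.SameCycle (β x) (β a)) a (Perm.SameCycle.refl _ _)
    (fun x hx hxa hP => (E_of (h x hx hxa)).trans hP)

lemma E_double {α β : Perm V} {c d : V}
    (h : ∀ x, α.SameCycle x c → x ≠ c → x ≠ d → β (α x) = α (β x)) :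
    ∀ x, α.SameCycle x c → α.SameCycle (β x) (β c) ∨ α.SameCycle (β x) (β d) :=
  reach α (fun x => α.SameCycle (β x) (β c) ∨ α.SameCycle (β x) (β d)) c
    (Or.inl (Perm.SameCycle.refl _ _))
    (fun x hx hxa hP => by
      by_cases hxd : x = d
      · right; rw [hxd]
      · exact hP.imp (E_of (h x hx hxa hxd)).trans (E_of (h x hx hxa hxd)).trans)

lemma E_path {α β : Perm V} {c d : V} (hcd : α.SameCycle c d)
    (h : ∀ x, α.SameCycle x c → x ≠ c → x ≠ d → β (α x) = α (β x)) :
    α.SameCycle (β (α c)) (β d) := by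
  obtain ⟨s, hs0, hs1, hs2⟩ := path α hcd
  have := comm_path α β (c := c) (s := s) (fun j h0 hj => h _
    (Perm.SameCycle.symm ⟨j, by rw [zpow_natCast]⟩) (hs2 j h0 hj).1 (hs2 j h0 hj).2)
    (s - 1) (by omega)
  rw [Nat.sub_add_cancel hs0, hs1] at this
  rw [this]
  exact ⟨(s - 1 : ℕ), by rw [zpow_natCast]⟩

lemma Cfg.cls {α β : Perm V} {A B C : Finset V} (h : Cfg α A B C) {z w : V} {S : Finset V}
    (hS : ∀ x ∈ S, α.SameCycle (β z) (β x)) (hw : w ∈ S) (hwz : w ≠ z) :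
    ((∀ x ∈ S, β x ∈ A) ∧ S.card ≤ A.card) ∨ ((∀ x ∈ S, β x ∈ B) ∧ S.card ≤ B.card) ∨
      ((∀ x ∈ S, β x ∈ C) ∧ S.card ≤ C.card) := by
  have cd : ∀ T : Finset V, (∀ x ∈ S, β x ∈ T) → (∀ x ∈ S, β x ∈ T) ∧ S.card ≤ T.card :=
    fun T hT => ⟨hT, Finset.card_le_card_of_injOn β hT β.injective.injOn⟩
  by_cases hA : β z ∈ A
  · exact Or.inl (cd A fun x hx => (h.sA _ hA _).1 (hS x hx))
  by_cases hB : β z ∈ B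
  · exact Or.inr (Or.inl (cd B fun x hx => (h.sB _ hB _).1 (hS x hx)))
  by_cases hC : β z ∈ C
  · exact Or.inr (Or.inr (cd C fun x hx => (h.sC _ hC _).1 (hS x hx)))
  exfalso
  have hf := h.fx _ hA hB hC
  obtain ⟨k, hk⟩ := hS w hw
  rw [Perm.zpow_apply_eq_self_of_apply_eq_self hf] at hk
  exact hwz (β.injective hk).symm

lemma Cfg.ne {α : Perm V} {A B C : Finset V} (h : Cfg α A B C) {a b c : V}
    (ha : a ∈ A) (hb : b ∈ B) (hc : c ∈ C) : a ≠ b ∧ a ≠ c ∧ b ≠ c :=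
  ⟨fun e => h.dAB a ha (e ▸ hb), fun e => h.dAC a ha (e ▸ hc), fun e => h.dBC b hb (e ▸ hc)⟩

lemma Cfg.card2 {α : Perm V} {A B C : Finset V} (h : Cfg α A B C) :
    (A ∪ B).card = A.card + B.card :=
  Finset.card_union_of_disjoint (Finset.disjoint_left.2 h.dAB)

lemma Cfg.card3 {α : Perm V} {A B C : Finset V} (h : Cfg α A B C) :
    (A ∪ B ∪ C).card = A.card + B.card + C.card := by
  rw [Finset.card_union_of_disjoint, h.card2]
  rw [Finset.disjoint_left]
  intro x hx
  rcases Finset.mem_union.1 hx with hx | hx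
  · exact h.dAC x hx
  · exact h.dBC x hx

/-- All three cycles cannot be merged. -/
lemma merged {α β : Perm V} {A B C : Finset V} (h : Cfg α A B C) {a b c z : V}
    (ha : a ∈ A) (hb : b ∈ B) (hc : c ∈ C)
    (hA : ∀ x ∈ A, α.SameCycle (β z) (β x)) (hB : ∀ x ∈ B, α.SameCycle (β z) (β x))
    (hC : ∀ x ∈ C, α.SameCycle (β z) (β x)) : False := by
  have hS : ∀ x ∈ A ∪ B ∪ C, α.SameCycle (β z) (β x) := by
    intro x hx
    simp only [Finset.mem_union] at hx
    rcases hx with (hx | hx) | hx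
    exacts [hA x hx, hB x hx, hC x hx]
  obtain ⟨w, hw, hwz⟩ : ∃ w ∈ A ∪ B ∪ C, w ≠ z := by
    by_cases haz : a = z
    · exact ⟨b, by simp [hb], fun e => (h.ne ha hb hc).1 (haz.trans e.symm)⟩
    · exact ⟨a, by simp [ha], haz⟩
  have c1 := Finset.card_pos.2 ⟨a, ha⟩
  have c2 := Finset.card_pos.2 ⟨b, hb⟩
  have c3 := Finset.card_pos.2 ⟨c, hc⟩
  have := h.cls hS hw hwz
  rw [h.card3] at this
  rcases this with h | h | h <;> omega

lemma core2 {α β : Perm V} {A B C : Finset V} (h : Cfg α A B C) {a b c d : V}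
    (ha : a ∈ A) (hb : b ∈ B) (hc : c ∈ C) (hd : d ∈ C)
    (hD : ∀ x, x ≠ a → x ≠ b → x ≠ c → x ≠ d → β (α x) = α (β x))
    (t1 : β (α b) = α (β a)) (t2 : β (α a) = α (β b))
    (t3 : β (α d) = α (β c)) (t4 : β (α c) = α (β d)) : Concl α β A B C := by
  have c1 := Finset.card_pos.2 ⟨a, ha⟩
  have c2 := Finset.card_pos.2 ⟨b, hb⟩
  have oA : ∀ x ∈ A, α x ∈ A := fun x hx => (h.sA x hx _).1 ⟨1, by simp⟩
  have oB : ∀ x ∈ B, α x ∈ B := fun x hx => (h.sB x hx _).1 ⟨1, by simp⟩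
  have hA : ∀ x ∈ A, α.SameCycle (β x) (β a) := fun x hx =>
    E_single (fun y hy hya => by
      have hy := (h.sA a ha y).1 hy.symm
      exact hD y hya (h.ne hy hb hc).1 (h.ne hy hb hc).2.1 (h.ne hy hb hd).2.1) x
      ((h.sA x hx a).2 ha)
  have hB : ∀ x ∈ B, α.SameCycle (β x) (β b) := fun x hx =>
    E_single (fun y hy hya => by
      have hy := (h.sB b hb y).1 hy.symm
      exact hD y (h.ne ha hy hc).1.symm hya (h.ne ha hy hc).2.2 (h.ne ha hy hd).2.2) x
      ((h.sB x hx b).2 hb)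
  have hC : ∀ x ∈ C, α.SameCycle (β x) (β c) ∨ α.SameCycle (β x) (β d) := fun x hx =>
    E_double (fun y hy hya hyd => by
      have hy := (h.sC c hc y).1 hy.symm
      exact hD y (h.ne ha hb hy).2.1.symm (h.ne ha hb hy).2.2.symm hya hyd) x
      ((h.sC x hx c).2 hc)
  have hab : α.SameCycle (β a) (β b) := (E_of t1).trans (hB _ (oB b hb))
  have hS : ∀ x ∈ A ∪ B, α.SameCycle (β a) (β x) := by
    intro x hx
    rcases Finset.mem_union.1 hx with hx | hx
    · exact (hA x hx).symm
    · exact hab.trans (hB x hx).symm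
  have hABC : (∀ x ∈ A ∪ B, β x ∈ C) ∧ A.card + B.card ≤ C.card := by
    have := h.cls hS (Finset.mem_union_right A hb) (h.ne ha hb hc).1.symm
    rw [h.card2] at this
    rcases this with h | h | h
    · omega
    · omega
    · exact h
  obtain ⟨hABC, hcard⟩ := hABC
  -- the image of `A ∪ B` is all of `C`
  have hinvt : ∀ y, β.symm y ∈ A ∪ B → β.symm (α y) ∈ A ∪ B := by
    intro y hy
    obtain ⟨x, rfl⟩ := β.surjective y
    rw [Equiv.symm_apply_apply] at hy
    by_cases hxa : x = a
    · rw [hxa, ← t1, Equiv.symm_apply_apply]; exact Finset.mem_union_right _ (oB b hb)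
    by_cases hxb : x = b
    · rw [hxb, ← t2, Equiv.symm_apply_apply]; exact Finset.mem_union_left _ (oA a ha)
    rcases Finset.mem_union.1 hy with hx | hx
    · rw [← hD x hxa hxb (h.ne hx hb hc).2.1 (h.ne hx hb hd).2.1, Equiv.symm_apply_apply]
      exact Finset.mem_union_left _ (oA x hx)
    · rw [← hD x hxa hxb (h.ne ha hx hc).2.2 (h.ne ha hx hd).2.2, Equiv.symm_apply_apply]
      exact Finset.mem_union_right _ (oB x hx)
  have hpow : ∀ k : ℕ, β.symm ((α ^ k) (β a)) ∈ A ∪ B := by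
    intro k
    induction k with
    | zero => simp [ha]
    | succ k ih => rw [pow_succ', Perm.mul_apply]; exact hinvt _ ih
  have hβa : β a ∈ C := hABC a (Finset.mem_union_left _ ha)
  have hsurj : ∀ y ∈ C, β.symm y ∈ A ∪ B := by
    intro y hy
    obtain ⟨i, _, rfl⟩ := ((h.sC _ hβa y).2 hy).exists_pow_eq'
    exact hpow i
  have hmaps : ∀ x, (x ∉ A ∧ x ∉ B ∧ x ∉ C) → (β x ∉ A ∧ β x ∉ B ∧ β x ∉ C) := by
    intro x hx
    have e : α (β x) = β x := by
      rw [← hD x (fun e => hx.1 (e ▸ ha)) (fun e => hx.2.1 (e ▸ hb)) (fun e => hx.2.2 (e ▸ hc))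
        (fun e => hx.2.2 (e ▸ hd)), h.fx x hx.1 hx.2.1 hx.2.2]
    exact ⟨fun hm => h.mA _ hm e, fun hm => h.mB _ hm e, fun hm => h.mC _ hm e⟩
  have hpres : ∀ x, (β x ∉ A ∧ β x ∉ B ∧ β x ∉ C) ↔ (x ∉ A ∧ x ∉ B ∧ x ∉ C) := by
    intro x
    refine ⟨fun hx => ?_, hmaps x⟩
    exact inv_on (fun x => x ∉ A ∧ x ∉ B ∧ x ∉ C) hmaps x hx
  have hβC : ∀ x ∈ C, β x ∈ A ∨ β x ∈ B := by
    intro x hx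
    by_contra hcon
    push Not at hcon
    by_cases hxC : β x ∈ C
    · have := hsurj _ hxC
      rw [Equiv.symm_apply_apply] at this
      rcases Finset.mem_union.1 this with hm | hm
      · exact h.dAC x hm hx
      · exact h.dBC x hm hx
    · exact ((hpres x).1 ⟨hcon.1, hcon.2, hxC⟩).2.2 hx
  rcases hβC c hc with hcA | hcB <;> rcases hβC d hd with hdA | hdB
  · exfalso
    have : C.card ≤ A.card := Finset.card_le_card_of_injOn β (fun x hx => by
      rcases hC x hx with e | e
      · exact (h.sA _ hcA _).1 e.symm
      · exact (h.sA _ hdA _).1 e.symm) β.injective.injOn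
    omega
  · exact core h ha hb hd hc (fun x x1 x2 x3 x4 => hD x x1 x2 x4 x3) t1 t2 t4 t3 hpres hcA hdB hβa
  · exact core h ha hb hc hd hD t1 t2 t3 t4 hpres hdA hcB hβa
  · exfalso
    have : C.card ≤ B.card := Finset.card_le_card_of_injOn β (fun x hx => by
      rcases hC x hx with e | e
      · exact (h.sB _ hcB _).1 e.symm
      · exact (h.sB _ hdB _).1 e.symm) β.injective.injOn
    omega

/-- Excluded pattern `(a c)(b d)`. -/
lemma bad1 {α β : Perm V} {A B C : Finset V} (h : Cfg α A B C) {a b c d : V}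
    (ha : a ∈ A) (hb : b ∈ B) (hc : c ∈ C) (hd : d ∈ C)
    (hD : ∀ x, x ≠ a → x ≠ b → x ≠ c → x ≠ d → β (α x) = α (β x))
    (t1 : β (α c) = α (β a)) (t2 : β (α a) = α (β c))
    (t4 : β (α b) = α (β d)) : False := by
  have oA : ∀ x ∈ A, α x ∈ A := fun x hx => (h.sA x hx _).1 ⟨1, by simp⟩
  have oB : ∀ x ∈ B, α x ∈ B := fun x hx => (h.sB x hx _).1 ⟨1, by simp⟩
  have hA : ∀ x ∈ A, α.SameCycle (β x) (β a) := fun x hx =>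
    E_single (fun y hy hya => by
      have hy := (h.sA a ha y).1 hy.symm
      exact hD y hya (h.ne hy hb hc).1 (h.ne hy hb hc).2.1 (h.ne hy hb hd).2.1) x
      ((h.sA x hx a).2 ha)
  have hB : ∀ x ∈ B, α.SameCycle (β x) (β b) := fun x hx =>
    E_single (fun y hy hya => by
      have hy := (h.sB b hb y).1 hy.symm
      exact hD y (h.ne ha hy hc).1.symm hya (h.ne ha hy hc).2.2 (h.ne ha hy hd).2.2) x
      ((h.sB x hx b).2 hb)
  have hDC : ∀ y, α.SameCycle y c → y ≠ c → y ≠ d → β (α y) = α (β y) := by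
    intro y hy hya hyd
    have hy := (h.sC c hc y).1 hy.symm
    exact hD y (h.ne ha hb hy).2.1.symm (h.ne ha hb hy).2.2.symm hya hyd
  have hC : ∀ x ∈ C, α.SameCycle (β x) (β c) ∨ α.SameCycle (β x) (β d) := fun x hx =>
    E_double hDC x ((h.sC x hx c).2 hc)
  have e1 : α.SameCycle (β a) (β d) := (E_of t1).trans (E_path ((h.sC c hc d).2 hd) hDC)
  have e2 : α.SameCycle (β c) (β a) := (E_of t2).trans (hA _ (oA a ha))
  have e3 : α.SameCycle (β d) (β b) := (E_of t4).trans (hB _ (oB b hb))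
  refine merged (β := β) (z := a) h ha hb hc (fun x hx => (hA x hx).symm)
    (fun x hx => (e1.trans e3).trans (hB x hx).symm) (fun x hx => ?_)
  rcases hC x hx with e | e
  · exact e2.symm.trans e.symm
  · exact e1.trans e.symm

/-- Excluded pattern `(a b c)`; also used for the pattern `(a b)(c d)` with `d` fixed by `α`. -/
lemma singles {α β : Perm V} {A B C : Finset V} (h : Cfg α A B C) {a b c : V}
    (ha : a ∈ A) (hb : b ∈ B) (hc : c ∈ C)
    (hD : ∀ x, x ∈ A ∨ x ∈ B ∨ x ∈ C → x ≠ a → x ≠ b → x ≠ c → β (α x) = α (β x)) :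
    (∀ x ∈ A, α.SameCycle (β x) (β a)) ∧ (∀ x ∈ B, α.SameCycle (β x) (β b)) ∧
    (∀ x ∈ C, α.SameCycle (β x) (β c)) := by
  refine ⟨fun x hx => E_single (fun y hy hya => ?_) x ((h.sA x hx a).2 ha),
    fun x hx => E_single (fun y hy hya => ?_) x ((h.sB x hx b).2 hb),
    fun x hx => E_single (fun y hy hya => ?_) x ((h.sC x hx c).2 hc)⟩
  · have hy := (h.sA a ha y).1 hy.symm
    exact hD y (by simp [hy]) hya (h.ne hy hb hc).1 (h.ne hy hb hc).2.1
  · have hy := (h.sB b hb y).1 hy.symm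
    exact hD y (by simp [hy]) (h.ne ha hy hc).1.symm hya (h.ne ha hy hc).2.2
  · have hy := (h.sC c hc y).1 hy.symm
    exact hD y (by simp [hy]) (h.ne ha hb hy).2.1.symm (h.ne ha hb hy).2.2.symm hya

lemma bad3 {α β : Perm V} {A B C : Finset V} (h : Cfg α A B C) {a b c : V}
    (ha : a ∈ A) (hb : b ∈ B) (hc : c ∈ C)
    (hD : ∀ x, x ∈ A ∨ x ∈ B ∨ x ∈ C → x ≠ a → x ≠ b → x ≠ c → β (α x) = α (β x))
    (t1 : β (α b) = α (β a)) (t2 : β (α c) = α (β b)) : False := by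
  obtain ⟨hA, hB, hC⟩ := singles h ha hb hc hD
  have e1 : α.SameCycle (β a) (β b) := (E_of t1).trans (hB _ ((h.sB b hb _).1 ⟨1, by simp⟩))
  have e2 : α.SameCycle (β b) (β c) := (E_of t2).trans (hC _ ((h.sC c hc _).1 ⟨1, by simp⟩))
  exact merged (β := β) (z := a) h ha hb hc (fun x hx => (hA x hx).symm)
    (fun x hx => e1.trans (hB x hx).symm) (fun x hx => (e1.trans e2).trans (hC x hx).symm)

lemma bad4 {α β : Perm V} {A B C : Finset V} (h : Cfg α A B C) {a b c d : V}
    (ha : a ∈ A) (hb : b ∈ B) (hc : c ∈ C) (hd : d ∉ A ∧ d ∉ B ∧ d ∉ C)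
    (hD : ∀ x, x ∈ A ∨ x ∈ B ∨ x ∈ C → x ≠ a → x ≠ b → x ≠ c → β (α x) = α (β x))
    (t1 : β (α b) = α (β a)) (t2 : β (α c) = α (β d)) : False := by
  obtain ⟨hA, hB, hC⟩ := singles h ha hb hc hD
  have e1 : α.SameCycle (β a) (β b) := (E_of t1).trans (hB _ ((h.sB b hb _).1 ⟨1, by simp⟩))
  have e2 : α.SameCycle (β d) (β c) := (E_of t2).trans (hC _ ((h.sC c hc _).1 ⟨1, by simp⟩))
  have c1 := Finset.card_pos.2 ⟨a, ha⟩
  have c2 := Finset.card_pos.2 ⟨b, hb⟩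
  have hS : ∀ x ∈ A ∪ B, α.SameCycle (β a) (β x) := by
    intro x hx
    rcases Finset.mem_union.1 hx with hx | hx
    · exact (hA x hx).symm
    · exact e1.trans (hB x hx).symm
  have k1 := h.cls hS (Finset.mem_union_right A hb) (h.ne ha hb hc).1.symm
  have hS' : ∀ x ∈ insert d C, α.SameCycle (β d) (β x) := by
    intro x hx
    rcases Finset.mem_insert.1 hx with hx | hx
    · rw [hx]
    · exact e2.trans (hC x hx).symm
  have k2 := h.cls hS' (Finset.mem_insert_of_mem hc) (fun e => hd.2.2 (e ▸ hc))
  rw [h.card2] at k1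
  rw [Finset.card_insert_of_notMem hd.2.2] at k2
  omega

lemma dec4 : ∀ τ : Perm (Fin 4), Perm.sign τ = 1 → (∀ x, τ x ≠ x) → ∀ x, τ (τ x) = x := by
  decide

lemma even4 (τ : Perm V) (hs : Perm.sign τ = 1) (hc : τ.support.card = 4) :
    ∀ x, τ (τ x) = x := by
  have hp : ∀ x, τ x ∈ τ.support ↔ x ∈ τ.support := fun x => Perm.apply_mem_support
  let t : Perm {x // x ∈ τ.support} := τ.subtypePerm hp
  have e : {x // x ∈ τ.support} ≃ Fin 4 := Fintype.equivFinOfCardEq (by rw [Fintype.card_coe, hc])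
  have ht : Perm.sign t = 1 := by
    have := (Perm.sign_subtypePerm τ hp (fun x hx => Perm.mem_support.2 hx)).trans hs
    convert this
  have key := dec4 (e.permCongr t) (by rw [Perm.sign_permCongr, ht]) (by
    intro x hx
    rw [Equiv.permCongr_apply, ← Equiv.eq_symm_apply] at hx
    have h1 := (e.symm x).2
    rw [Perm.mem_support] at h1
    exact h1 (congrArg Subtype.val hx))
  intro x
  by_cases hx : x ∈ τ.support
  · have := key (e ⟨x, hx⟩)
    simp only [Equiv.permCongr_apply, Equiv.symm_apply_apply, EmbeddingLike.apply_eq_iff_eq] at this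
    exact congrArg Subtype.val this
  · rw [Perm.notMem_support] at hx
    rw [hx, hx]

lemma fourC {α β τ : Perm V} {A B C : Finset V} (h : Cfg α A B C) {a b c d : V}
    (hτ : ∀ x, β (α (τ x)) = α (β x))
    (hinv : ∀ x, τ (τ x) = x)
    (ha : a ∈ A) (hb : b ∈ B) (hc : c ∈ C) (hd : d ∈ C) (hcd : c ≠ d)
    (hs : ∀ x, τ x ≠ x ↔ x = a ∨ x = b ∨ x = c ∨ x = d) : Concl α β A B C := by
  have hab := h.ne ha hb hc
  have had := h.ne ha hb hd
  have hD : ∀ x, x ≠ a → x ≠ b → x ≠ c → x ≠ d → β (α x) = α (β x) := by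
    intro x x1 x2 x3 x4
    have e : τ x = x := by
      by_contra hx
      have := (hs x).1 hx
      tauto
    have := hτ x
    rwa [e] at this
  have hm : ∀ x, τ x ≠ x → τ x = a ∨ τ x = b ∨ τ x = c ∨ τ x = d := fun x hx =>
    (hs (τ x)).1 (fun e => hx (τ.injective e))
  have ta := (hs a).2 (by simp)
  have tb := (hs b).2 (by simp)
  have tc := (hs c).2 (by simp)
  have td := (hs d).2 (by simp)
  have T : ∀ {x y}, τ x = y → β (α y) = α (β x) := fun e => e ▸ hτ _
  have R : ∀ {x y}, τ x = y → τ y = x := fun e => e ▸ hinv _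
  rcases hm a ta with e | e | e | e
  · exact absurd e ta
  · have e' := R e
    have e2 : τ c = d := by
      rcases hm c tc with f | f | f | f
      · exact absurd (τ.injective (f.trans e'.symm)) hab.2.2.symm
      · exact absurd (τ.injective (f.trans e.symm)) hab.2.1.symm
      · exact absurd f tc
      · exact f
    exact core2 h ha hb hc hd hD (T e) (T e') (T e2) (T (R e2))
  · exfalso
    have e' := R e
    have e2 : τ b = d := by
      rcases hm b tb with f | f | f | f
      · exact absurd (τ.injective (f.trans e'.symm)) hab.2.2
      · exact absurd f tb
      · exact absurd (τ.injective (f.trans e.symm)) hab.1.symm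
      · exact f
    exact bad1 h ha hb hc hd hD (T e) (T e') (T (R e2))
  · exfalso
    have e' := R e
    have e2 : τ b = c := by
      rcases hm b tb with f | f | f | f
      · exact absurd (τ.injective (f.trans e'.symm)) had.2.2
      · exact absurd f tb
      · exact f
      · exact absurd (τ.injective (f.trans e.symm)) hab.1.symm
    exact bad1 h ha hb hd hc (fun x x1 x2 x3 x4 => hD x x1 x2 x4 x3) (T e) (T e') (T (R e2))

lemma fourOut {α β τ : Perm V} {A B C : Finset V} (h : Cfg α A B C) {a b c d : V}
    (hτ : ∀ x, β (α (τ x)) = α (β x))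
    (hinv : ∀ x, τ (τ x) = x)
    (ha : a ∈ A) (hb : b ∈ B) (hc : c ∈ C) (hd : d ∉ A ∧ d ∉ B ∧ d ∉ C)
    (hs : ∀ x, τ x ≠ x ↔ x = a ∨ x = b ∨ x = c ∨ x = d) : False := by
  have hab := h.ne ha hb hc
  have hD : ∀ x, x ∈ A ∨ x ∈ B ∨ x ∈ C → x ≠ a → x ≠ b → x ≠ c → β (α x) = α (β x) := by
    intro x hx x1 x2 x3
    have e : τ x = x := by
      by_contra hx'
      rcases (hs x).1 hx' with e | e | e | e
      · exact x1 e
      · exact x2 e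
      · exact x3 e
      · subst e; tauto
    have := hτ x
    rwa [e] at this
  have hm : ∀ x, τ x ≠ x → τ x = a ∨ τ x = b ∨ τ x = c ∨ τ x = d := fun x hx =>
    (hs (τ x)).1 (fun e => hx (τ.injective e))
  have ta := (hs a).2 (by simp)
  have tb := (hs b).2 (by simp)
  have tc := (hs c).2 (by simp)
  have td := (hs d).2 (by simp)
  have T : ∀ {x y}, τ x = y → β (α y) = α (β x) := fun e => e ▸ hτ _
  have R : ∀ {x y}, τ x = y → τ y = x := fun e => e ▸ hinv _
  have inj : ∀ {x y z}, τ x = z → τ y = z → x = y := fun e f => τ.injective (e.trans f.symm)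
  rcases hm d td with e | e | e | e
  · have e2 : τ b = c := by
      rcases hm b tb with f | f | f | f
      · exact absurd (inj e f ▸ hb) hd.2.1
      · exact absurd f tb
      · exact f
      · exact absurd (inj f (R e)) hab.1.symm
    exact bad4 h.swap.swap' hb hc ha ⟨hd.2.1, hd.2.2, hd.1⟩
      (fun x hx x1 x2 x3 => hD x (by tauto) x3 x1 x2) (T e2) (T e)
  · have e2 : τ a = c := by
      rcases hm a ta with f | f | f | f
      · exact absurd f ta
      · exact absurd (inj e f ▸ ha) hd.1
      · exact f
      · exact absurd (inj f (R e)) hab.1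
    exact bad4 h.swap' ha hc hb ⟨hd.1, hd.2.2, hd.2.1⟩
      (fun x hx x1 x2 x3 => hD x (by tauto) x1 x3 x2) (T e2) (T e)
  · have e2 : τ a = b := by
      rcases hm a ta with f | f | f | f
      · exact absurd f ta
      · exact f
      · exact absurd (inj e f ▸ ha) hd.1
      · exact absurd (inj f (R e)) hab.2.1
    exact bad4 h ha hb hc hd hD (T e2) (T e)
  · exact td e

lemma three {α β τ : Perm V} {A B C : Finset V} (h : Cfg α A B C) {a b c : V}
    (hτ : ∀ x, β (α (τ x)) = α (β x))
    (ha : a ∈ A) (hb : b ∈ B) (hc : c ∈ C)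
    (hs : ∀ x, τ x ≠ x ↔ x = a ∨ x = b ∨ x = c) : False := by
  have hab := h.ne ha hb hc
  have hD : ∀ x, x ∈ A ∨ x ∈ B ∨ x ∈ C → x ≠ a → x ≠ b → x ≠ c → β (α x) = α (β x) := by
    intro x hx x1 x2 x3
    have e : τ x = x := by
      by_contra hx'
      have := (hs x).1 hx'
      tauto
    have := hτ x
    rwa [e] at this
  have hm : ∀ x, τ x ≠ x → τ x = a ∨ τ x = b ∨ τ x = c := fun x hx =>
    (hs (τ x)).1 (fun e => hx (τ.injective e))
  have ta := (hs a).2 (by simp)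
  have tb := (hs b).2 (by simp)
  have tc := (hs c).2 (by simp)
  have T : ∀ {x y}, τ x = y → β (α y) = α (β x) := fun e => e ▸ hτ _
  have inj : ∀ {x y z}, τ x = z → τ y = z → x = y := fun e f => τ.injective (e.trans f.symm)
  rcases hm a ta with e | e | e
  · exact ta e
  · rcases hm b tb with f | f | f
    · rcases hm c tc with g | g | g
      · exact hab.2.2 (inj f g)
      · exact hab.2.1 (inj e g)
      · exact tc g
    · exact tb f
    · exact bad3 h ha hb hc hD (T e) (T f)
  · rcases hm c tc with f | f | f
    · rcases hm b tb with g | g | g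
      · exact hab.2.2 (inj g f)
      · exact tb g
      · exact hab.1 (inj e g)
    · exact bad3 h.swap' ha hc hb (fun x hx x1 x2 x3 => hD x (by tauto) x1 x3 x2) (T e) (T f)
    · exact tc f

lemma main {α β τ : Perm V} {A B C : Finset V} (h : Cfg α A B C) {a b c : V}
    (hτ : ∀ x, β (α (τ x)) = α (β x)) (hsign : Perm.sign τ = 1)
    (ha : a ∈ A) (hb : b ∈ B) (hc : c ∈ C)
    (ta : τ a ≠ a) (tb : τ b ≠ b) (tc : τ c ≠ c) (hcard : τ.support.card ≤ 4) :
    Concl α β A B C := by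
  have hab := h.ne ha hb hc
  by_cases hex : ∃ d, τ d ≠ d ∧ d ≠ a ∧ d ≠ b ∧ d ≠ c
  · obtain ⟨d, td, da, db, dc⟩ := hex
    have hsub : ({a, b, c, d} : Finset V) ⊆ τ.support := by
      intro x hx
      simp only [Finset.mem_insert, Finset.mem_singleton] at hx
      rw [Perm.mem_support]
      rcases hx with rfl | rfl | rfl | rfl <;> assumption
    have h4 : ({a, b, c, d} : Finset V).card = 4 := by
      rw [Finset.card_eq_succ]
      refine ⟨a, {b, c, d}, ?_, rfl, ?_⟩
      · simp [hab.1, hab.2.1, da.symm]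
      · rw [Finset.card_eq_three]
        exact ⟨b, c, d, hab.2.2, db.symm, dc.symm, rfl⟩
    have heq := Finset.eq_of_subset_of_card_le hsub (by omega)
    have hinv := even4 τ hsign (by rw [← heq, h4])
    have hs : ∀ x, τ x ≠ x ↔ x = a ∨ x = b ∨ x = c ∨ x = d := by
      intro x
      rw [← Perm.mem_support, ← heq]
      simp
    by_cases hdA : d ∈ A
    · have := fourC (d := a) (c := d) (a := b) (b := c) h.swap.swap' hτ hinv hb hc hdA ha da
        (fun x => by rw [hs x]; tauto)
      exact this.swap'.swap
    by_cases hdB : d ∈ B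
    · have := fourC (d := b) (c := d) (a := a) (b := c) h.swap' hτ hinv ha hc hdB hb db
        (fun x => by rw [hs x]; tauto)
      exact this.swap'
    by_cases hdC : d ∈ C
    · exact fourC h hτ hinv ha hb hc hdC dc.symm hs
    · exact (fourOut h hτ hinv ha hb hc ⟨hdA, hdB, hdC⟩ hs).elim
  · exfalso
    refine three h hτ ha hb hc (fun x => ⟨fun hx => ?_, ?_⟩)
    · by_contra hcon
      push Not at hcon
      exact hex ⟨x, hx, hcon⟩
    · rintro (rfl | rfl | rfl) <;> assumption

/-- A cycle of `α` on which `β` commutes with `α` is conjugated to a cycle of `α`. -/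
lemma conj_mem {α β a₁ : Perm V} {A B C : Finset V} (h : Cfg α A B C)
    (hA : a₁.support = A) (haA : ∀ x ∈ A, a₁ x = α x)
    (hcomm : ∀ x ∈ A, β (α x) = α (β x)) (hne : A.Nonempty) :
    ∃ T, (T = A ∨ T = B ∨ T = C) ∧
      ∀ a₂ : Perm V, a₂.support = T → (∀ x ∈ T, a₂ x = α x) → β⁻¹ * a₂ * β = a₁ := by
  obtain ⟨a, ha⟩ := hne
  have oA : ∀ x ∈ A, α x ∈ A := fun x hx => (h.sA x hx _).1 ⟨1, by simp⟩
  have hpow : ∀ k : ℕ, (α ^ k) a ∈ A ∧ (α ^ k) (β a) = β ((α ^ k) a) := by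
    intro k
    induction k with
    | zero => simp [ha]
    | succ k ih =>
      rw [pow_succ', Perm.mul_apply, Perm.mul_apply, ih.2, hcomm _ ih.1]
      exact ⟨oA _ ih.1, rfl⟩
  obtain ⟨T, hT, hsT, haT⟩ : ∃ T, (T = A ∨ T = B ∨ T = C) ∧
      (∀ x ∈ T, ∀ y, α.SameCycle x y ↔ y ∈ T) ∧ β a ∈ T := by
    have hm : α (β a) ≠ β a := by
      rw [← hcomm a ha]
      exact fun e => h.mA a ha (β.injective e)
    by_cases h1 : β a ∈ A
    · exact ⟨A, by simp, h.sA, h1⟩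
    by_cases h2 : β a ∈ B
    · exact ⟨B, by simp, h.sB, h2⟩
    by_cases h3 : β a ∈ C
    · exact ⟨C, by simp, h.sC, h3⟩
    exact absurd (h.fx _ h1 h2 h3) hm
  have hiff : ∀ x, β x ∈ T ↔ x ∈ A := by
    intro x
    rw [← hsT _ haT]
    constructor
    · intro hx
      obtain ⟨i, _, hi⟩ := hx.exists_pow_eq'
      rw [(hpow i).2] at hi
      rw [← β.injective hi]
      exact (hpow i).1
    · intro hx
      obtain ⟨i, _, rfl⟩ := ((h.sA a ha x).2 hx).exists_pow_eq'
      exact ⟨i, by rw [zpow_natCast, (hpow i).2]⟩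
  refine ⟨T, hT, fun a₂ h2 h3 => ?_⟩
  rw [mul_assoc, inv_mul_eq_iff_eq_mul]
  ext x
  by_cases hx : x ∈ A
  · rw [Perm.mul_apply, Perm.mul_apply, haA x hx, h3 _ ((hiff x).2 hx), hcomm x hx]
  · have e1 : a₁ x = x := by rw [← Perm.notMem_support, hA]; exact hx
    have e2 : a₂ (β x) = β x := by
      rw [← Perm.notMem_support, h2]; exact fun e => hx ((hiff x).1 e)
    rw [Perm.mul_apply, Perm.mul_apply, e1, e2]

lemma final {α a₁ γ : Perm V} (hA : ∀ x ∈ a₁.support, a₁ x = α x)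
    (h1 : ∀ x, α (γ (α x)) = γ x) (h2 : ∀ x ∈ a₁.support, γ x ∈ a₁.support) :
    γ⁻¹ * a₁ * γ = a₁⁻¹ := by
  rw [mul_assoc, inv_mul_eq_iff_eq_mul, eq_mul_inv_iff_mul_eq]
  ext x
  rw [Perm.mul_apply, Perm.mul_apply]
  by_cases hx : x ∈ a₁.support
  · have hx' := Perm.apply_mem_support.2 hx
    rw [hA _ (h2 _ hx'), hA x hx, h1]
  · have e : a₁ x = x := Perm.notMem_support.1 hx
    rw [e, ← Perm.notMem_support]
    exact fun hm => hx (inv_on (fun x => x ∈ a₁.support) h2 x hm)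

lemma sameCycle_iff {α a₁ : Perm V} (hc : a₁.IsCycle) (hA : ∀ x ∈ a₁.support, a₁ x = α x) :
    ∀ x ∈ a₁.support, ∀ y, α.SameCycle x y ↔ y ∈ a₁.support := by
  intro x hx y
  have hpow : ∀ k : ℕ, (α ^ k) x ∈ a₁.support ∧ (α ^ k) x = (a₁ ^ k) x := by
    intro k
    induction k with
    | zero => exact ⟨by simpa using hx, by simp⟩
    | succ k ih =>
      rw [pow_succ', Perm.mul_apply, pow_succ', Perm.mul_apply, ← ih.2, hA _ ih.1]
      refine ⟨?_, rfl⟩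
      rw [← hA _ ih.1]
      exact Perm.apply_mem_support.2 ih.1
  constructor
  · intro h
    obtain ⟨i, _, rfl⟩ := h.exists_pow_eq'
    exact (hpow i).1
  · intro h
    obtain ⟨i, _, rfl⟩ := (hc.sameCycle (Perm.mem_support.1 hx) (Perm.mem_support.1 h)).exists_pow_eq'
    exact ⟨i, by rw [zpow_natCast, (hpow i).2]⟩

end ThreeCycles


/-- Proposition 4.5: α = α₁α₂α₃ a product of three disjoint nontrivial cycles,
[α,β] nontrivial moving at most 4 points, and conjugation by β sends no αᵢ
into {α₁, α₂, α₃}; then some γ simultaneously inverts α₁, α₂, α₃ and β. -/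
theorem stmt_12 {n : ℕ} (α α₁ α₂ α₃ β : Equiv.Perm (Fin n))
    (hα : α = α₁ * α₂ * α₃) (h₁ : α₁.IsCycle) (h₂ : α₂.IsCycle) (h₃ : α₃.IsCycle)
    (hd12 : α₁.Disjoint α₂) (hd13 : α₁.Disjoint α₃) (hd23 : α₂.Disjoint α₃)
    (h1 : 0 < (α⁻¹ * β⁻¹ * α * β).support.card)
    (h2 : (α⁻¹ * β⁻¹ * α * β).support.card ≤ 4)
    (hc1 : β⁻¹ * α₁ * β ∉ ({α₁, α₂, α₃} : Set (Equiv.Perm (Fin n))))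
    (hc2 : β⁻¹ * α₂ * β ∉ ({α₁, α₂, α₃} : Set (Equiv.Perm (Fin n))))
    (hc3 : β⁻¹ * α₃ * β ∉ ({α₁, α₂, α₃} : Set (Equiv.Perm (Fin n)))) :
    ∃ γ : Equiv.Perm (Fin n), γ⁻¹ * α₁ * γ = α₁⁻¹ ∧ γ⁻¹ * α₂ * γ = α₂⁻¹ ∧
      γ⁻¹ * α₃ * γ = α₃⁻¹ ∧ γ⁻¹ * β * γ = β⁻¹ := by
  classical
  have d12 : ∀ x, x ∈ α₁.support → x ∉ α₂.support := fun x h =>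
    Finset.disjoint_left.1 hd12.disjoint_support h
  have d13 : ∀ x, x ∈ α₁.support → x ∉ α₃.support := fun x h =>
    Finset.disjoint_left.1 hd13.disjoint_support h
  have d23 : ∀ x, x ∈ α₂.support → x ∉ α₃.support := fun x h =>
    Finset.disjoint_left.1 hd23.disjoint_support h
  have f : ∀ {σ : Equiv.Perm (Fin n)} {x}, x ∉ σ.support → σ x = x :=
    fun h => Equiv.Perm.notMem_support.1 h
  have v1 : ∀ x ∈ α₁.support, α₁ x = α x := by
    intro x hx
    rw [hα, Equiv.Perm.mul_apply, Equiv.Perm.mul_apply, f (d13 x hx), f (d12 x hx)]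
  have v2 : ∀ x ∈ α₂.support, α₂ x = α x := by
    intro x hx
    rw [hα, Equiv.Perm.mul_apply, Equiv.Perm.mul_apply, f (d23 x hx),
      f (fun h => d12 _ h (Equiv.Perm.apply_mem_support.2 hx))]
  have v3 : ∀ x ∈ α₃.support, α₃ x = α x := by
    intro x hx
    have hx' := Equiv.Perm.apply_mem_support.2 hx
    rw [hα, Equiv.Perm.mul_apply, Equiv.Perm.mul_apply, f (fun h => d23 _ h hx'),
      f (fun h => d13 _ h hx')]
  have cfg : ThreeCycles.Cfg α α₁.support α₂.support α₃.support :=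
    { dAB := d12
      dAC := d13
      dBC := d23
      sA := ThreeCycles.sameCycle_iff h₁ v1
      sB := ThreeCycles.sameCycle_iff h₂ v2
      sC := ThreeCycles.sameCycle_iff h₃ v3
      mA := fun x hx => v1 x hx ▸ Equiv.Perm.mem_support.1 hx
      mB := fun x hx => v2 x hx ▸ Equiv.Perm.mem_support.1 hx
      mC := fun x hx => v3 x hx ▸ Equiv.Perm.mem_support.1 hx
      fx := fun x x1 x2 x3 => by
        rw [hα, Equiv.Perm.mul_apply, Equiv.Perm.mul_apply, f x3, f x2, f x1] }
  set τ := α⁻¹ * β⁻¹ * α * β with hτdef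
  have hτ : ∀ x, β (α (τ x)) = α (β x) := by
    intro x
    have : β * α * τ = α * β := by rw [hτdef]; group
    exact congrArg (fun σ : Equiv.Perm (Fin n) => σ x) this
  have hsign : Equiv.Perm.sign τ = 1 := by
    rw [hτdef]
    simp only [map_mul, map_inv]
    rw [mul_comm (Equiv.Perm.sign α)⁻¹]
    simp [mul_assoc]
  have com : ∀ x, τ x = x → β (α x) = α (β x) := fun x hx => by
    have := hτ x
    rwa [hx] at this
  have ne : ∀ {σ : Equiv.Perm (Fin n)}, σ.IsCycle → σ.support.Nonempty := fun h =>
    Finset.nonempty_iff_ne_empty.2 (fun e => h.ne_one (Equiv.Perm.support_eq_empty_iff.1 e))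
  simp only [Set.mem_insert_iff, Set.mem_singleton_iff, not_or] at hc1 hc2 hc3
  have ex1 : ∃ a ∈ α₁.support, τ a ≠ a := by
    by_contra hcon
    push Not at hcon
    obtain ⟨T, hT, hT'⟩ := ThreeCycles.conj_mem (β := β) cfg rfl v1
      (fun x hx => com x (hcon x hx)) (ne h₁)
    rcases hT with rfl | rfl | rfl
    · exact hc1.1 (hT' α₁ rfl v1)
    · exact hc2.1 (hT' α₂ rfl v2)
    · exact hc3.1 (hT' α₃ rfl v3)
  have ex2 : ∃ a ∈ α₂.support, τ a ≠ a := by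
    by_contra hcon
    push Not at hcon
    obtain ⟨T, hT, hT'⟩ := ThreeCycles.conj_mem (β := β) cfg.swap rfl v2
      (fun x hx => com x (hcon x hx)) (ne h₂)
    rcases hT with rfl | rfl | rfl
    · exact hc2.2.1 (hT' α₂ rfl v2)
    · exact hc1.2.1 (hT' α₁ rfl v1)
    · exact hc3.2.1 (hT' α₃ rfl v3)
  have ex3 : ∃ a ∈ α₃.support, τ a ≠ a := by
    by_contra hcon
    push Not at hcon
    obtain ⟨T, hT, hT'⟩ := ThreeCycles.conj_mem (β := β) cfg.swap'.swap rfl v3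
      (fun x hx => com x (hcon x hx)) (ne h₃)
    rcases hT with rfl | rfl | rfl
    · exact hc3.2.2 (hT' α₃ rfl v3)
    · exact hc1.2.2 (hT' α₁ rfl v1)
    · exact hc2.2.2 (hT' α₂ rfl v2)
  obtain ⟨a, ha, ta⟩ := ex1
  obtain ⟨b, hb, tb⟩ := ex2
  obtain ⟨c, hc, tc⟩ := ex3
  obtain ⟨γ, g1, g2, g3, g4, g5⟩ := ThreeCycles.main cfg hτ hsign ha hb hc ta tb tc h2
  refine ⟨γ, ThreeCycles.final v1 g1 g3, ThreeCycles.final v2 g1 g4, ThreeCycles.final v3 g1 g5, ?_⟩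
  rw [mul_assoc, inv_mul_eq_iff_eq_mul, eq_mul_inv_iff_mul_eq]
  ext x
  rw [Equiv.Perm.mul_apply, Equiv.Perm.mul_apply, g2]
end
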